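/- Let q be a prime power and 𝔽_q the finite field with q elements. Let F ∈ 𝔽_q[x_1,…,x_n] (n ≥ 3) be an absolutely irreducible homogeneous polynomial of total degree d ≥ 1. If q > (1/2)·(3d⁴ − 4d³ + 5d²), then there exists a point x ∈ 𝔽_q^n with F(x) = 0 and ∇F(x) ≠ 0, i.e. F has a non-singular zero over 𝔽_q. -/

import Mathlib

section PlaneCurve

open Polynomial

/-- Bivariate polynomials (in `k[X][Y]`) of total degree at most `m`. -/
def boundedBideg (k : Type*) [CommRing k] (m : ℕ) : Submodule k k[X][X] where
  carrier := {r | ∀ i l, m < i + l → (r.coeff l).coeff i = 0}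
  add_mem' := fun ha hb i l h => by simp [ha i l h, hb i l h]
  zero_mem' := fun i l _ => by simp
  smul_mem' := fun c r hr i l h => by simp [hr i l h]

namespace boundedBideg

variable {k : Type*} [CommRing k] {m n : ℕ}

theorem mono (h : m ≤ n) : boundedBideg k m ≤ boundedBideg k n :=
  fun _ hr i l hil => hr i l (h.trans_lt hil)

theorem mul_mem {r s : k[X][X]} (hr : r ∈ boundedBideg k m) (hs : s ∈ boundedBideg k n) :
    r * s ∈ boundedBideg k (m + n) := by
  intro i l h
  rw [coeff_mul, finsetSum_coeff]
  refine Finset.sum_eq_zero fun a ha => ?_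
  rw [coeff_mul]
  refine Finset.sum_eq_zero fun b hb => ?_
  rw [Finset.HasAntidiagonal.mem_antidiagonal] at ha hb
  rcases lt_or_ge m (b.1 + a.1) with h1 | h1
  · rw [hr _ _ h1, zero_mul]
  · rw [hs b.2 a.2 (by omega), mul_zero]

theorem monomial_mem {i l : ℕ} (h : i + l ≤ m) (c : k) :
    monomial l (monomial i c) ∈ boundedBideg k m := by
  intro i' l' h'
  rw [coeff_monomial]
  split_ifs with h1
  · rw [coeff_monomial, if_neg (by omega)]
  · simp

theorem modByMonic_mem {f r : k[X][X]} (hf : f.Monic) (hfd : f ∈ boundedBideg k f.natDegree)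
    (hr : r ∈ boundedBideg k m) : r %ₘ f ∈ boundedBideg k m := by
  nontriviality k
  induction hD : r.natDegree using Nat.strong_induction_on generalizing r with
  | _ D ih =>
    by_cases hlt : r.degree < f.degree
    · rwa [(modByMonic_eq_self_iff hf).2 hlt]
    have hle : f.natDegree ≤ r.natDegree := by
      rw [not_lt] at hlt
      exact natDegree_le_natDegree hlt
    rcases Nat.eq_zero_or_pos f.natDegree with h0 | hpos
    · rw [hf.natDegree_eq_zero.1 h0]
      simp
    have hr0 : r ≠ 0 := by
      rintro rfl
      simp at hle
      omega
    set p : k[X][X] := C r.leadingCoeff * X ^ (r.natDegree - f.natDegree) with hp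
    have hpm : f * p ∈ boundedBideg k m := by
      intro i l h
      rw [hp, ← mul_assoc, coeff_mul_X_pow', coeff_mul_C]
      split_ifs with hl
      · rw [coeff_mul]
        refine Finset.sum_eq_zero fun b hb => ?_
        rw [Finset.HasAntidiagonal.mem_antidiagonal] at hb
        rcases lt_or_ge m (b.2 + r.natDegree) with h1 | h1
        · rw [leadingCoeff, hr _ _ h1, mul_zero]
        · rw [hfd b.1 _ (by omega), zero_mul]
      · simp
    have key : r %ₘ f = (r - f * p) %ₘ f := by
      rw [sub_modByMonic, mul_comm f, mul_self_modByMonic hf, sub_zero]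
    rw [key]
    by_cases h0 : r - f * p = 0
    · simp [h0]
    refine ih _ ?_ (Submodule.sub_mem _ hr hpm) rfl
    have hdeg : (r - f * p).degree < r.degree := by
      have := div_wf_lemma ⟨not_lt.1 hlt, hr0⟩ hf
      rwa [hp]
    rw [← hD]
    exact natDegree_lt_natDegree h0 hdeg

theorem of_C_mul_mem [IsDomain k] {P : k[X]} (hP : P ≠ 0) {s : k[X][X]}
    (h : C P * s ∈ boundedBideg k m) {i l : ℕ} (hil : m < i + l + P.natDegree) :
    (s.coeff l).coeff i = 0 := by
  by_cases hs : s.coeff l = 0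
  · simp [hs]
  apply coeff_eq_zero_of_natDegree_lt
  by_contra hcon
  have := h (P.natDegree + (s.coeff l).natDegree) l (by omega)
  rw [coeff_C_mul, coeff_mul_degree_add_degree] at this
  simp [hP, hs] at this

end boundedBideg

/-- `f` is monic of degree `d` in the second variable and has total degree at most `d`. -/
structure IsPlaneModel {k : Type*} [CommRing k] (f : k[X][X]) (d : ℕ) : Prop where
  monic : f.Monic
  natDegree_eq : f.natDegree = d
  mem_boundedBideg : f ∈ boundedBideg k d

/-- The image of the polynomials of total degree at most `m` in the coordinate ring of `f`. -/
noncomputable def degreeFiltration {k : Type*} [CommRing k] (f : k[X][X]) (m : ℕ) :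
    Submodule k (AdjoinRoot f) :=
  (boundedBideg k m).map ((AdjoinRoot.mkₐ f).restrictScalars k).toLinearMap

/-- The number of monomials `x ^ i * y ^ l` with `i + l ≤ m` and `l < d`. -/
def countMonomials (d m : ℕ) : ℕ := ∑ l : Fin d, (m + 1 - l)

namespace degreeFiltration

section Ring

variable {k : Type*} [CommRing k] {f : k[X][X]} {d m n : ℕ}

theorem mem_iff {z : AdjoinRoot f} :
    z ∈ degreeFiltration f m ↔ ∃ r ∈ boundedBideg k m, AdjoinRoot.mk f r = z := Iff.rfl

theorem mk_mem {r : k[X][X]} (hr : r ∈ boundedBideg k m) :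
    AdjoinRoot.mk f r ∈ degreeFiltration f m := ⟨r, hr, rfl⟩

theorem mono (h : m ≤ n) : degreeFiltration f m ≤ degreeFiltration f n :=
  Submodule.map_mono (boundedBideg.mono h)

theorem mul_mem {a b : AdjoinRoot f} (ha : a ∈ degreeFiltration f m)
    (hb : b ∈ degreeFiltration f n) : a * b ∈ degreeFiltration f (m + n) := by
  obtain ⟨r, hr, rfl⟩ := mem_iff.1 ha
  obtain ⟨s, hs, rfl⟩ := mem_iff.1 hb
  exact mem_iff.2 ⟨r * s, boundedBideg.mul_mem hr hs, by simp⟩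

theorem of_mem {p : k[X]} (hp : p.natDegree ≤ m) : AdjoinRoot.of f p ∈ degreeFiltration f m := by
  refine ⟨C p, fun i l h => ?_, rfl⟩
  rw [coeff_C]
  split_ifs with hl
  · exact coeff_eq_zero_of_natDegree_lt (by omega)
  · simp

theorem of_mul_root_pow_mem {p : k[X]} {l : ℕ} (hp : p.natDegree + l ≤ m) :
    AdjoinRoot.of f p * AdjoinRoot.root f ^ l ∈ degreeFiltration f m := by
  refine ⟨C p * X ^ l, fun i l' h => ?_, by simp⟩
  rw [coeff_C_mul_X_pow]
  split_ifs with hl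
  · exact coeff_eq_zero_of_natDegree_lt (by omega)
  · simp

theorem algebraMap_mem (c : k) : algebraMap k (AdjoinRoot f) c ∈ degreeFiltration f m := by
  have : algebraMap k (AdjoinRoot f) c = AdjoinRoot.of f (C c) := rfl
  rw [this]
  exact of_mem (by simp)

theorem one_mem : (1 : AdjoinRoot f) ∈ degreeFiltration f m := by
  simpa using algebraMap_mem (f := f) (m := m) 1

theorem pow_mem {a : AdjoinRoot f} (ha : a ∈ degreeFiltration f m) (j : ℕ) :
    a ^ j ∈ degreeFiltration f (j * m) := by
  induction j with
  | zero => simpa using algebraMap_mem (f := f) (m := 0) 1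
  | succ j ih =>
    rw [pow_succ, Nat.succ_mul]
    exact mul_mem ih ha

theorem exists_mem (z : AdjoinRoot f) : ∃ m, z ∈ degreeFiltration f m := by
  obtain ⟨r, rfl⟩ := AdjoinRoot.mk_surjective z
  refine ⟨r.natDegree + ∑ l ∈ Finset.range (r.natDegree + 1), (r.coeff l).natDegree,
    mk_mem fun i l h => ?_⟩
  by_cases hl : l ≤ r.natDegree
  · apply coeff_eq_zero_of_natDegree_lt
    have : (r.coeff l).natDegree ≤ ∑ l ∈ Finset.range (r.natDegree + 1), (r.coeff l).natDegree :=
      Finset.single_le_sum (f := fun l => (r.coeff l).natDegree) (fun _ _ => Nat.zero_le _)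
        (Finset.mem_range.2 (Nat.lt_succ_of_le hl))
    omega
  · rw [coeff_eq_zero_of_natDegree_lt (not_le.1 hl), coeff_zero]

theorem mk_modByMonic (r : k[X][X]) :
    AdjoinRoot.mk f (r %ₘ f) = AdjoinRoot.mk f r := by
  simp [modByMonic_eq_sub_mul_div]

theorem exists_normalForm [Nontrivial k] (hf : IsPlaneModel f d) {z : AdjoinRoot f}
    (hz : z ∈ degreeFiltration f m) :
    ∃ r ∈ boundedBideg k m, r.degree < f.degree ∧ AdjoinRoot.mk f r = z := by
  obtain ⟨r, hr, rfl⟩ := mem_iff.1 hz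
  refine ⟨r %ₘ f, boundedBideg.modByMonic_mem hf.monic ?_ hr, degree_modByMonic_lt _ hf.monic, ?_⟩
  · rw [hf.natDegree_eq]
    exact hf.mem_boundedBideg
  · exact mk_modByMonic _

theorem normalForm_injective (hf : f.Monic) {r s : k[X][X]} (hr : r.degree < f.degree)
    (hs : s.degree < f.degree) (h : AdjoinRoot.mk f r = AdjoinRoot.mk f s) : r = s := by
  rw [← sub_eq_zero, ← map_sub, AdjoinRoot.mk_eq_zero] at h
  by_contra hne
  exact hf.not_dvd_of_degree_lt (sub_ne_zero.2 hne)
    ((degree_sub_le _ _).trans_lt (max_lt hr hs)) h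

theorem exists_normalForm' (hf : f.Monic) [Nontrivial k] (z : AdjoinRoot f) :
    ∃ r : k[X][X], r.degree < f.degree ∧ AdjoinRoot.mk f r = z := by
  obtain ⟨r, rfl⟩ := AdjoinRoot.mk_surjective z
  exact ⟨r %ₘ f, degree_modByMonic_lt _ hf, mk_modByMonic _⟩

theorem of_mul_mem [IsDomain k] (hf : IsPlaneModel f d) {P : k[X]} (hP : P ≠ 0)
    {z : AdjoinRoot f} (h : AdjoinRoot.of f P * z ∈ degreeFiltration f m)
    (hn : m ≤ n + P.natDegree) : z ∈ degreeFiltration f n ∧ (m < P.natDegree → z = 0) := by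
  obtain ⟨s, hs, rfl⟩ := exists_normalForm' hf.monic z
  obtain ⟨r, hr, hrd, hrz⟩ := exists_normalForm hf h
  have hCs : (C P * s).degree < f.degree := by
    rwa [degree_mul, degree_C hP, zero_add]
  have : r = C P * s := normalForm_injective hf.monic hrd hCs (by rw [hrz]; simp)
  subst this
  refine ⟨mk_mem fun i l hil => boundedBideg.of_C_mul_mem hP hr (by omega), fun hlt => ?_⟩
  have : s = 0 := by
    ext l i
    simpa using boundedBideg.of_C_mul_mem hP hr (i := i) (l := l) (by omega)
  simp [this]

end Ring

section Field

variable {k : Type*} [Field k] {f : k[X][X]} {d m n : ℕ}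

/-- The linear map assembling an element of the coordinate ring from its normal form. -/
noncomputable def ofCoeffs (f : k[X][X]) (d m : ℕ) :
    (∀ l : Fin d, degreeLT k (m + 1 - l)) →ₗ[k] AdjoinRoot f :=
  ((AdjoinRoot.mkₐ f).restrictScalars k).toLinearMap ∘ₗ
    ∑ l : Fin d, ((monomial (R := k[X]) (l : ℕ)).restrictScalars k) ∘ₗ
      (degreeLT k (m + 1 - l)).subtype ∘ₗ LinearMap.proj l

theorem ofCoeffs_apply (c : ∀ l : Fin d, degreeLT k (m + 1 - l)) :
    ofCoeffs f d m c = AdjoinRoot.mk f (∑ l : Fin d, monomial (l : ℕ) (c l : k[X])) := by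
  simp [ofCoeffs]

theorem range_ofCoeffs (hf : IsPlaneModel f d) :
    LinearMap.range (ofCoeffs f d m) = degreeFiltration f m := by
  ext z
  constructor
  · rintro ⟨c, rfl⟩
    rw [ofCoeffs_apply]
    refine mk_mem (Submodule.sum_mem _ fun l _ => fun i l' h => ?_)
    rw [coeff_monomial]
    split_ifs with h1
    · have := mem_degreeLT.1 (c l).2
      exact coeff_eq_zero_of_degree_lt (this.trans_le (by exact_mod_cast (by omega)))
    · simp
  · intro hz
    obtain ⟨r, hr, hrd, rfl⟩ := exists_normalForm hf hz
    have hdeg : r.natDegree < d ∨ r = 0 := by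
      by_cases h0 : r = 0
      · exact Or.inr h0
      · exact Or.inl (hf.natDegree_eq ▸ natDegree_lt_natDegree h0 hrd)
    refine ⟨fun l => ⟨r.coeff l, mem_degreeLT.2 ?_⟩, ?_⟩
    · rw [degree_lt_iff_coeff_zero]
      intro i hi
      exact hr i l (by omega)
    · rw [ofCoeffs_apply]
      congr 1
      rcases hdeg with hdeg | rfl
      · conv_rhs => rw [r.as_sum_range' d hdeg]
        exact Fin.sum_univ_eq_sum_range (fun l => monomial l (r.coeff l)) d
      · simp

theorem ofCoeffs_injective (hf : IsPlaneModel f d) : Function.Injective (ofCoeffs f d m) := by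
  have hdeg : ∀ c : (∀ l : Fin d, degreeLT k (m + 1 - l)),
      (∑ l : Fin d, monomial (l : ℕ) (c l : k[X])).degree < f.degree := by
    intro c
    rw [degree_eq_natDegree hf.monic.ne_zero, hf.natDegree_eq]
    refine (degree_sum_le _ _).trans_lt ((Finset.sup_lt_iff (WithBot.bot_lt_coe d)).2 ?_)
    intro l _
    exact (degree_monomial_le _ _).trans_lt (Nat.cast_lt.2 l.2)
  intro c c' h
  rw [ofCoeffs_apply, ofCoeffs_apply] at h
  have := normalForm_injective hf.monic (hdeg c) (hdeg c') h
  ext1 l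
  ext1
  have h2 := congrArg (fun p => p.coeff (l : ℕ)) this
  simpa [coeff_monomial, Fin.val_inj] using h2

instance finiteDimensional_degreeLT (n : ℕ) : FiniteDimensional k (degreeLT k n) :=
  (degreeLTEquiv k n).symm.finiteDimensional

theorem finrank_degreeLT (n : ℕ) : Module.finrank k (degreeLT k n) = n := by
  rw [(degreeLTEquiv k n).finrank_eq, Module.finrank_fin_fun]

theorem finiteDimensional (hf : IsPlaneModel f d) (m : ℕ) :
    FiniteDimensional k (degreeFiltration f m) := by
  rw [← range_ofCoeffs hf]
  infer_instance

theorem finrank_eq (hf : IsPlaneModel f d) (m : ℕ) :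
    Module.finrank k (degreeFiltration f m) = countMonomials d m := by
  rw [← range_ofCoeffs hf, LinearMap.finrank_range_of_inj (ofCoeffs_injective hf),
    Module.finrank_pi_fintype]
  simp [finrank_degreeLT, countMonomials]

end Field

end degreeFiltration

theorem two_mul_countMonomials_add {d m : ℕ} (h : d ≤ m + 2) :
    2 * countMonomials d m + d * d = d * (2 * m + 3) := by
  rw [countMonomials, Fin.sum_univ_eq_sum_range (fun l => m + 1 - l) d]
  induction d with
  | zero => simp
  | succ d ih =>
    rw [Finset.sum_range_succ]
    have h1 := ih (by omega)
    obtain ⟨c, hc⟩ : ∃ c, m + 1 = d + c := ⟨m + 1 - d, by omega⟩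
    have h2 : m + 1 - d = c := by omega
    rw [h2]
    have h3 : m = d + c - 1 := by omega
    zify at *
    nlinarith

section Bezout

variable {k : Type*} [Field k] {f : k[X][X]} {d m : ℕ}

theorem AdjoinRoot.of_injective_of_natDegree_pos (hpos : 0 < f.natDegree) :
    Function.Injective (AdjoinRoot.of f) :=
  AdjoinRoot.of.injective_of_degree_ne_zero (natDegree_pos_iff_degree_pos.1 hpos).ne'

theorem natDegree_le_of_mem_degreeLT_succ {n : ℕ} {p : k[X]} (hp : p ∈ degreeLT k (n + 1)) :
    p.natDegree ≤ n := by
  rw [degreeLT_succ_eq_degreeLE, mem_degreeLE] at hp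
  exact natDegree_le_of_degree_le hp

/-- A nonzero element of degree at most `m` on a plane curve of degree `d` has a nonzero multiple
depending only on the first coordinate, of degree at most `d * m`. -/
theorem exists_mul_eq_of_of_mem_degreeFiltration [IsDomain (AdjoinRoot f)] (hf : IsPlaneModel f d)
    (hd : 1 ≤ d) {g : AdjoinRoot f} (hg : g ∈ degreeFiltration f m) (hg0 : g ≠ 0) :
    ∃ n : k[X], n ≠ 0 ∧ n.natDegree ≤ d * m ∧ ∃ h, g * h = AdjoinRoot.of f n := by
  have := degreeFiltration.finiteDimensional hf
  set N := d * m + d with hN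
  let φ : (degreeFiltration f N × degreeLT k (d * m + 1)) →ₗ[k] AdjoinRoot f :=
    LinearMap.coprod (LinearMap.mulLeft k g ∘ₗ (degreeFiltration f N).subtype)
      (-(((Algebra.linearMap k[X] (AdjoinRoot f)).restrictScalars k) ∘ₗ
        (degreeLT k (d * m + 1)).subtype))
  have hφ : ∀ u, φ u = g * u.1 - AdjoinRoot.of f (u.2 : k[X]) := fun u => by
    simp [φ, sub_eq_add_neg]
  have hmem : ∀ u, φ u ∈ degreeFiltration f (m + N) := by
    intro u
    rw [hφ]
    refine Submodule.sub_mem _ (degreeFiltration.mul_mem hg u.1.2) (degreeFiltration.of_mem ?_)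
    have := natDegree_le_of_mem_degreeLT_succ u.2.2
    omega
  have hrank : Module.finrank k (degreeFiltration f (m + N)) <
      Module.finrank k (degreeFiltration f N × degreeLT k (d * m + 1)) := by
    rw [Module.finrank_prod, degreeFiltration.finrank_eq hf, degreeFiltration.finrank_eq hf,
      degreeFiltration.finrank_degreeLT]
    have h1 := two_mul_countMonomials_add (d := d) (m := m + N) (by omega)
    have h2 := two_mul_countMonomials_add (d := d) (m := N) (by omega)
    nlinarith
  obtain ⟨u, hu, hu0⟩ := Submodule.exists_mem_ne_zero_of_ne_bot
    (LinearMap.ker_ne_bot_of_finrank_lt (f := φ.codRestrict _ hmem) hrank)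
  have hu' : g * u.1 = AdjoinRoot.of f (u.2 : k[X]) := by
    rw [← sub_eq_zero, ← hφ]
    exact congrArg Subtype.val hu
  refine ⟨u.2, fun h0 => hu0 ?_, ?_, u.1, hu'⟩
  · rw [h0, map_zero, mul_eq_zero, or_iff_right hg0] at hu'
    exact Prod.ext (Subtype.ext hu') (Subtype.ext h0)
  · have := natDegree_le_of_mem_degreeLT_succ u.2.2
    omega

end Bezout

section Points

variable {k : Type*} [Field k] {f : k[X][X]} {d m : ℕ}

/-- The pair `(u, v)` of elements of a `k`-algebra is a point of the curve `f = 0`. -/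
def IsCurvePoint (f : k[X][X]) {B : Type*} [CommRing B] [Algebra k B] (u v : B) : Prop :=
  f.eval₂ (aeval u : k[X] →ₐ[k] B) v = 0

namespace IsCurvePoint

variable {B : Type*} [CommRing B] [Algebra k B] {u v : B}

/-- Evaluation of elements of the coordinate ring at a point of the curve. -/
noncomputable def hom (h : IsCurvePoint f u v) : AdjoinRoot f →ₐ[k] B :=
  AdjoinRoot.liftAlgHom f (aeval u) v h

@[simp]
theorem hom_of (h : IsCurvePoint f u v) (p : k[X]) : h.hom (AdjoinRoot.of f p) = aeval u p :=
  AdjoinRoot.liftAlgHom_of f _ _ h p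

@[simp]
theorem hom_root (h : IsCurvePoint f u v) : h.hom (AdjoinRoot.root f) = v :=
  AdjoinRoot.liftAlgHom_root f _ _ h

@[simp]
theorem hom_mk (h : IsCurvePoint f u v) (r : k[X][X]) :
    h.hom (AdjoinRoot.mk f r) = r.eval₂ (aeval u : k[X] →ₐ[k] B) v :=
  AdjoinRoot.liftAlgHom_mk f _ _ h r

theorem _root_.isCurvePoint_of_algHom (g : AdjoinRoot f →ₐ[k] B) :
    IsCurvePoint f (g (AdjoinRoot.of f X)) (g (AdjoinRoot.root f)) := by
  have h1 : ((aeval (g (AdjoinRoot.of f X)) : k[X] →ₐ[k] B) : k[X] →+* B) =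
      (g : AdjoinRoot f →+* B).comp (AdjoinRoot.of f) := by
    have : (aeval (g (AdjoinRoot.of f X)) : k[X] →ₐ[k] B) =
        g.comp (AdjoinRoot.ofAlgHom k f) := by
      ext
      simp
    rw [this]
    rfl
  rw [IsCurvePoint, h1]
  have h2 := hom_eval₂ f (AdjoinRoot.of f) (g : AdjoinRoot f →+* B) (AdjoinRoot.root f)
  rw [AdjoinRoot.eval₂_root, map_zero] at h2
  exact h2.symm

theorem _root_.isCurvePoint_self : IsCurvePoint f (AdjoinRoot.of f X) (AdjoinRoot.root f) :=
  isCurvePoint_of_algHom (AlgHom.id k _)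

theorem _root_.AdjoinRoot.algHom_ext_of_X {g₁ g₂ : AdjoinRoot f →ₐ[k] B}
    (hX : g₁ (AdjoinRoot.of f X) = g₂ (AdjoinRoot.of f X))
    (hY : g₁ (AdjoinRoot.root f) = g₂ (AdjoinRoot.root f)) : g₁ = g₂ := by
  refine AdjoinRoot.algHom_ext' ?_ hY
  ext
  simpa using hX

end IsCurvePoint

theorem isCurvePoint_iff_eval {x₀ y₀ : k} :
    IsCurvePoint f x₀ y₀ ↔ (f.map (evalRingHom x₀)).eval y₀ = 0 := by
  rw [IsCurvePoint, eval_map]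
  rfl

theorem IsCurvePoint.hom_mk_eq_eval {x₀ y₀ : k} (h : IsCurvePoint f x₀ y₀) (r : k[X][X]) :
    h.hom (AdjoinRoot.mk f r) = (r.map (evalRingHom x₀)).eval y₀ := by
  rw [hom_mk, eval_map]
  rfl

theorem of_X_sub_C_dvd_mk_iff {x₀ : k} {r : k[X][X]} :
    AdjoinRoot.of f (X - C x₀) ∣ AdjoinRoot.mk f r ↔
      f.map (evalRingHom x₀) ∣ r.map (evalRingHom x₀) := by
  constructor
  · rintro ⟨z, hz⟩
    obtain ⟨s, rfl⟩ := AdjoinRoot.mk_surjective z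
    have : AdjoinRoot.mk f r = AdjoinRoot.mk f (C (X - C x₀) * s) := by rw [hz]; simp
    obtain ⟨t, ht⟩ := AdjoinRoot.mk_eq_mk.1 this
    refine ⟨t.map (evalRingHom x₀), ?_⟩
    rw [← Polynomial.map_mul, ← ht]
    simp
  · rintro ⟨w, hw⟩
    have h0 : (r - f * w.map C).map (evalRingHom x₀) = 0 := by
      have h1 : (evalRingHom x₀).comp C = RingHom.id k := by ext; simp
      rw [Polynomial.map_sub, Polynomial.map_mul, hw, Polynomial.map_map, h1, Polynomial.map_id,
        sub_self]
    have h2 : C (X - C x₀) ∣ r - f * w.map C := by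
      rw [C_dvd_iff_dvd_coeff]
      intro i
      rw [dvd_iff_isRoot]
      have := congrArg (fun p => p.coeff i) h0
      rwa [coeff_map, coeff_zero] at this
    obtain ⟨s, hs⟩ := h2
    refine ⟨AdjoinRoot.mk f s, ?_⟩
    have h3 := congrArg (AdjoinRoot.mk f) hs
    simpa using h3

/-- At a point where the curve is transversal to the vertical line, the vertical coordinate
vanishes to at least the same order as the horizontal one, up to a function `u` which is
invertible at the point. -/
theorem IsCurvePoint.exists_mul_root_sub_eq {x₀ y₀ : k} (h : IsCurvePoint f x₀ y₀)
    (hd : (derivative (f.map (evalRingHom x₀))).eval y₀ ≠ 0) :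
    ∃ u : AdjoinRoot f, AdjoinRoot.of f (X - C x₀) ∣
      u * (AdjoinRoot.root f - algebraMap k _ y₀) ∧ h.hom u ≠ 0 := by
  obtain ⟨v, hv⟩ := dvd_iff_isRoot.2 (isCurvePoint_iff_eval.1 h)
  have h1 : (evalRingHom x₀).comp C = RingHom.id k := by ext; simp
  refine ⟨AdjoinRoot.mk f (v.map C), ?_, ?_⟩
  · have h2 : AdjoinRoot.mk f (v.map C) * (AdjoinRoot.root f - algebraMap k _ y₀) =
        AdjoinRoot.mk f ((v * (X - C y₀)).map C) := by
      simp only [Polynomial.map_mul, Polynomial.map_sub, map_X, map_C, map_mul, map_sub,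
        AdjoinRoot.mk_X, AdjoinRoot.mk_C]
      rfl
    rw [h2, of_X_sub_C_dvd_mk_iff, Polynomial.map_map, h1, Polynomial.map_id, hv, mul_comm]
  · rw [hom_mk_eq_eval, Polynomial.map_map, h1, Polynomial.map_id]
    rw [hv] at hd
    simpa using hd

theorem exists_forall_eval_ne_zero_of_ne_zero [IsDomain (AdjoinRoot f)] (hf : IsPlaneModel f d)
    (hd : 1 ≤ d) {z : AdjoinRoot f} (hz : z ≠ 0) :
    ∃ n : k[X], n ≠ 0 ∧ ∀ x₀ y₀ (h : IsCurvePoint f x₀ y₀), n.eval x₀ ≠ 0 → h.hom z ≠ 0 := by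
  obtain ⟨m, hm⟩ := degreeFiltration.exists_mem z
  obtain ⟨n, hn, -, g, hg⟩ := exists_mul_eq_of_of_mem_degreeFiltration hf hd hm hz
  refine ⟨n, hn, fun x₀ y₀ h hne h0 => hne ?_⟩
  have := congrArg h.hom hg
  rw [map_mul, h0, zero_mul, IsCurvePoint.hom_of] at this
  simpa [coe_aeval_eq_eval] using this.symm

theorem mk_derivative_ne_zero (hf : IsPlaneModel f d) (hder : derivative f ≠ 0) :
    AdjoinRoot.mk f (derivative f) ≠ 0 := by
  rw [Ne, AdjoinRoot.mk_eq_zero]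
  exact hf.monic.not_dvd_of_degree_lt hder (degree_derivative_lt hf.monic.ne_zero)

theorem exists_forall_eval_derivative_ne_zero [IsDomain (AdjoinRoot f)] (hf : IsPlaneModel f d)
    (hd : 1 ≤ d) (hder : derivative f ≠ 0) :
    ∃ n : k[X], n ≠ 0 ∧ ∀ x₀ y₀, n.eval x₀ ≠ 0 → (f.map (evalRingHom x₀)).eval y₀ = 0 →
      (derivative (f.map (evalRingHom x₀))).eval y₀ ≠ 0 := by
  obtain ⟨n, hn, h⟩ :=
    exists_forall_eval_ne_zero_of_ne_zero hf hd (mk_derivative_ne_zero hf hder)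
  refine ⟨n, hn, fun x₀ y₀ hne h0 => ?_⟩
  have := h x₀ y₀ (isCurvePoint_iff_eval.2 h0) hne
  rwa [IsCurvePoint.hom_mk_eq_eval, ← derivative_map] at this

theorem card_roots_toFinset_of_derivative_ne_zero [IsAlgClosed k] [DecidableEq k] {p : k[X]}
    (hp : p ≠ 0) (h : ∀ y, p.eval y = 0 → (derivative p).eval y ≠ 0) :
    p.roots.toFinset.card = p.natDegree := by
  rw [(IsAlgClosed.splits p).natDegree_eq_card_roots, Multiset.toFinset_card_of_nodup]
  rw [Multiset.nodup_iff_count_le_one]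
  intro y
  rw [count_roots]
  by_contra hcon
  obtain ⟨h1, h2⟩ := (one_lt_rootMultiplicity_iff_isRoot hp).1 (not_le.1 hcon)
  exact h y h1 h2

end Points

section Expansion

variable {k : Type*} [CommRing k] {m : ℕ}

theorem boundedBideg.natDegree_le {r : k[X][X]} (hr : r ∈ boundedBideg k m) :
    r.natDegree ≤ m := by
  rw [natDegree_le_iff_coeff_eq_zero]
  intro l hl
  ext i
  exact hr i l (by omega)

theorem boundedBideg.eq_sum_monomial {r : k[X][X]} (hr : r ∈ boundedBideg k m) :
    r = ∑ l ∈ Finset.range (m + 1), ∑ i ∈ Finset.range (m + 1),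
      monomial l (monomial i ((r.coeff l).coeff i)) := by
  conv_lhs => rw [r.as_sum_range' (m + 1) (Nat.lt_succ_of_le (natDegree_le hr))]
  refine Finset.sum_congr rfl fun l _ => ?_
  rw [← map_sum]
  congr 1
  refine (r.coeff l).as_sum_range' (m + 1) (Nat.lt_succ_of_le ?_)
  rw [natDegree_le_iff_coeff_eq_zero]
  intro i hi
  exact hr i l (by omega)

end Expansion

section TwoPoints

open scoped TensorProduct

variable {k : Type*} [Field k] {f : k[X][X]} {d m n : ℕ}

theorem IsCurvePoint.exists_hom_ne_zero [IsAlgClosed k] [IsDomain (AdjoinRoot f)]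
    (hf : IsPlaneModel f d) (hd : 1 ≤ d) {z : AdjoinRoot f} (hz : z ≠ 0) :
    ∃ (x₀ y₀ : k) (h : IsCurvePoint f x₀ y₀), h.hom z ≠ 0 := by
  obtain ⟨n, hn, hnz⟩ := exists_forall_eval_ne_zero_of_ne_zero hf hd hz
  obtain ⟨x₀, hx₀⟩ : ∃ x₀, n.eval x₀ ≠ 0 := by
    by_contra! hcon
    exact hn (funext (by simpa using hcon))
  obtain ⟨y₀, hy₀⟩ := IsAlgClosed.exists_root (f.map (evalRingHom x₀)) (by
    rw [hf.monic.degree_map, degree_eq_natDegree hf.monic.ne_zero, hf.natDegree_eq]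
    exact_mod_cast (by omega : d ≠ 0))
  exact ⟨x₀, y₀, isCurvePoint_iff_eval.2 hy₀, hnz _ _ _ hx₀⟩

/-- The `k`-algebra homomorphism `a ⊗ b ↦ a * ψ b`. -/
noncomputable def graphHom {A : Type*} [CommRing A] [Algebra k A] (ψ : A →ₐ[k] A) :
    A ⊗[k] A →ₐ[k] A :=
  Algebra.TensorProduct.productMap (AlgHom.id k A) ψ

@[simp]
theorem graphHom_tmul {A : Type*} [CommRing A] [Algebra k A] (ψ : A →ₐ[k] A) (a b : A) :
    graphHom ψ (a ⊗ₜ[k] b) = a * ψ b := by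
  simp [graphHom]

/-- Evaluation at a point, as an endomorphism of the coordinate ring. -/
noncomputable def IsCurvePoint.constHom {x₀ y₀ : k} (h : IsCurvePoint f x₀ y₀) :
    AdjoinRoot f →ₐ[k] AdjoinRoot f :=
  (Algebra.ofId k (AdjoinRoot f)).comp h.hom

theorem IsCurvePoint.constHom_apply {x₀ y₀ : k} (h : IsCurvePoint f x₀ y₀) (z : AdjoinRoot f) :
    h.constHom z = algebraMap k _ (h.hom z) := rfl

theorem eq_zero_of_forall_graphHom_constHom_eq_zero [IsAlgClosed k] [IsDomain (AdjoinRoot f)]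
    (hf : IsPlaneModel f d) (hd : 1 ≤ d) {z : AdjoinRoot f ⊗[k] AdjoinRoot f}
    (hz : ∀ (x₀ y₀ : k) (h : IsCurvePoint f x₀ y₀), graphHom h.constHom z = 0) : z = 0 := by
  let b := Module.Basis.ofVectorSpace k (AdjoinRoot f)
  obtain ⟨c, rfl⟩ := TensorProduct.eq_repr_basis_left b z
  suffices hc : c = 0 by simp [hc]
  ext i
  by_contra hci
  obtain ⟨x₀, y₀, h, hne⟩ := IsCurvePoint.exists_hom_ne_zero hf hd hci
  have h1 := hz x₀ y₀ h
  rw [Finsupp.sum, map_sum] at h1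
  have h2 : ∑ i ∈ c.support, h.hom (c i) • b i = 0 := by
    rw [← h1]
    refine Finset.sum_congr rfl fun j _ => ?_
    rw [graphHom_tmul, IsCurvePoint.constHom_apply, Algebra.smul_def, mul_comm]
  refine hne (linearIndependent_iff'.1 b.linearIndependent _ _ h2 i ?_)
  simpa using hci

/-- The difference of the first coordinates of two points. -/
noncomputable def diffX (f : k[X][X]) : AdjoinRoot f ⊗[k] AdjoinRoot f :=
  AdjoinRoot.of f X ⊗ₜ 1 - 1 ⊗ₜ AdjoinRoot.of f X

/-- The difference of the second coordinates of two points. -/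
noncomputable def diffY (f : k[X][X]) : AdjoinRoot f ⊗[k] AdjoinRoot f :=
  AdjoinRoot.root f ⊗ₜ 1 - 1 ⊗ₜ AdjoinRoot.root f

theorem graphHom_diffX (ψ : AdjoinRoot f →ₐ[k] AdjoinRoot f) :
    graphHom ψ (diffX f) = AdjoinRoot.of f X - ψ (AdjoinRoot.of f X) := by
  simp [diffX]

theorem graphHom_diffY (ψ : AdjoinRoot f →ₐ[k] AdjoinRoot f) :
    graphHom ψ (diffY f) = AdjoinRoot.root f - ψ (AdjoinRoot.root f) := by
  simp [diffY]

theorem eq_zero_of_diffX_mul_eq_zero [IsAlgClosed k] [IsDomain (AdjoinRoot f)]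
    (hf : IsPlaneModel f d) (hd : 1 ≤ d) {z : AdjoinRoot f ⊗[k] AdjoinRoot f}
    (hz : diffX f * z = 0) : z = 0 := by
  refine eq_zero_of_forall_graphHom_constHom_eq_zero hf hd fun x₀ y₀ h => ?_
  have h1 := congrArg (graphHom h.constHom) hz
  rw [map_mul, map_zero, mul_eq_zero, graphHom_diffX] at h1
  refine h1.resolve_left fun h2 => ?_
  have h3 : AdjoinRoot.of f (X - C x₀) = 0 := by
    rw [← h2, map_sub, IsCurvePoint.constHom_apply, IsCurvePoint.hom_of]
    simp
    rfl
  have h4 := AdjoinRoot.of_injective_of_natDegree_pos (f := f) (by rw [hf.natDegree_eq]; omega)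
    (h3.trans (map_zero _).symm)
  exact X_sub_C_ne_zero x₀ h4

/-- The span of the products `a ⊗ b` with `a` of degree at most `m` and `b` of degree at most
`n`. -/
noncomputable def bidegreeFiltration (f : k[X][X]) (m n : ℕ) :
    Submodule k (AdjoinRoot f ⊗[k] AdjoinRoot f) :=
  LinearMap.range (TensorProduct.map (degreeFiltration f m).subtype
    (degreeFiltration f n).subtype)

namespace bidegreeFiltration

theorem tmul_mem {a b : AdjoinRoot f} (ha : a ∈ degreeFiltration f m)
    (hb : b ∈ degreeFiltration f n) : a ⊗ₜ b ∈ bidegreeFiltration f m n :=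
  ⟨⟨a, ha⟩ ⊗ₜ ⟨b, hb⟩, by simp⟩

theorem le_iff {P : Submodule k (AdjoinRoot f ⊗[k] AdjoinRoot f)} :
    bidegreeFiltration f m n ≤ P ↔
      ∀ a ∈ degreeFiltration f m, ∀ b ∈ degreeFiltration f n, a ⊗ₜ b ∈ P := by
  refine ⟨fun h a ha b hb => h (tmul_mem ha hb), fun h => ?_⟩
  rintro _ ⟨w, rfl⟩
  induction w using TensorProduct.induction_on with
  | zero => simp
  | tmul a b => simpa using h a a.2 b b.2
  | add a b ha hb => rw [map_add]; exact P.add_mem ha hb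

theorem mono {m' n' : ℕ} (hm : m ≤ m') (hn : n ≤ n') :
    bidegreeFiltration f m n ≤ bidegreeFiltration f m' n' :=
  le_iff.2 fun _ ha _ hb => tmul_mem (degreeFiltration.mono hm ha) (degreeFiltration.mono hn hb)

theorem mul_mem {m' n' : ℕ} {z w : AdjoinRoot f ⊗[k] AdjoinRoot f}
    (hz : z ∈ bidegreeFiltration f m n) (hw : w ∈ bidegreeFiltration f m' n') :
    z * w ∈ bidegreeFiltration f (m + m') (n + n') := by
  have h1 : bidegreeFiltration f m n ≤
      (bidegreeFiltration f (m + m') (n + n')).comap (LinearMap.mulRight k w) := by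
    refine le_iff.2 fun a ha b hb => ?_
    have h2 : bidegreeFiltration f m' n' ≤
        (bidegreeFiltration f (m + m') (n + n')).comap (LinearMap.mulLeft k (a ⊗ₜ[k] b)) := by
      refine le_iff.2 fun a' ha' b' hb' => ?_
      simpa using tmul_mem (degreeFiltration.mul_mem ha ha') (degreeFiltration.mul_mem hb hb')
    simpa using h2 hw
  simpa using h1 hz

theorem finiteDimensional (hf : IsPlaneModel f d) (m n : ℕ) :
    FiniteDimensional k (bidegreeFiltration f m n) := by
  have := degreeFiltration.finiteDimensional hf
  rw [bidegreeFiltration]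
  infer_instance

theorem finrank_eq (hf : IsPlaneModel f d) (m n : ℕ) :
    Module.finrank k (bidegreeFiltration f m n) = countMonomials d m * countMonomials d n := by
  rw [bidegreeFiltration, LinearMap.finrank_range_of_inj, Module.finrank_tensorProduct,
    degreeFiltration.finrank_eq hf, degreeFiltration.finrank_eq hf]
  exact TensorProduct.map_injective_of_flat_flat _ _ (Submodule.injective_subtype _)
    (Submodule.injective_subtype _)

theorem graphHom_constHom_mem {x₀ y₀ : k} (h : IsCurvePoint f x₀ y₀)
    {z : AdjoinRoot f ⊗[k] AdjoinRoot f} (hz : z ∈ bidegreeFiltration f m n) :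
    graphHom h.constHom z ∈ degreeFiltration f m := by
  have : bidegreeFiltration f m n ≤
      (degreeFiltration f m).comap (graphHom h.constHom).toLinearMap := by
    refine le_iff.2 fun a ha b hb => ?_
    simpa [IsCurvePoint.constHom_apply] using degreeFiltration.mul_mem ha
      (degreeFiltration.algebraMap_mem (f := f) (m := 0) (h.hom b))
  exact this hz

theorem diffX_mem : diffX f ∈ bidegreeFiltration f 1 1 :=
  Submodule.sub_mem _
    (tmul_mem (degreeFiltration.of_mem (by simp)) degreeFiltration.one_mem)
    (tmul_mem degreeFiltration.one_mem (degreeFiltration.of_mem (by simp)))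

end bidegreeFiltration

/-- Functions on pairs of points with high contact to the diagonal. -/
def diagonalContact (f : k[X][X]) (j : ℕ) : Submodule k (AdjoinRoot f ⊗[k] AdjoinRoot f) where
  carrier := {z | ∀ s ≤ j, diffX f ^ s ∣ diffY f ^ s * z}
  add_mem' := fun ha hb s hs => by
    rw [mul_add]
    exact dvd_add (ha s hs) (hb s hs)
  zero_mem' := fun s _ => by simp
  smul_mem' := fun c z hz s hs => by
    rw [mul_smul_comm, Algebra.smul_def]
    exact (hz s hs).mul_left _

namespace diagonalContact

theorem mem_zero (z : AdjoinRoot f ⊗[k] AdjoinRoot f) : z ∈ diagonalContact f 0 := by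
  intro s hs
  simp [Nat.le_zero.1 hs]

theorem mul_mem {i j : ℕ} {z w : AdjoinRoot f ⊗[k] AdjoinRoot f} (hz : z ∈ diagonalContact f i)
    (hw : w ∈ diagonalContact f j) : z * w ∈ diagonalContact f (i + j) := by
  intro s hs
  obtain ⟨s₁, s₂, rfl, h1, h2⟩ : ∃ s₁ s₂, s = s₁ + s₂ ∧ s₁ ≤ i ∧ s₂ ≤ j :=
    ⟨min s i, s - min s i, by omega, by omega, by omega⟩
  rw [pow_add, pow_add, mul_mul_mul_comm]
  exact mul_dvd_mul (hz s₁ h1) (hw s₂ h2)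

theorem mem_one_of_dvd {z : AdjoinRoot f ⊗[k] AdjoinRoot f} (h : diffX f ∣ diffY f * z) :
    z ∈ diagonalContact f 1 := by
  intro s hs
  interval_cases s
  · simp
  · simpa using h

theorem diffX_mem : diffX f ∈ diagonalContact f 1 :=
  mem_one_of_dvd (dvd_mul_left _ _)

end diagonalContact

end TwoPoints

section Secant

open scoped TensorProduct

variable {k : Type*} [Field k] {f : k[X][X]} {d m n : ℕ}

theorem boundedBideg.eval₂_eq_sum {r : k[X][X]} (hr : r ∈ boundedBideg k m) {B : Type*}
    [CommRing B] [Algebra k B] (u v : B) :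
    r.eval₂ (aeval u : k[X] →ₐ[k] B) v =
      ∑ l ∈ Finset.range (m + 1), ∑ i ∈ Finset.range (m + 1),
        (r.coeff l).coeff i • (u ^ i * v ^ l) := by
  conv_lhs => rw [boundedBideg.eq_sum_monomial hr]
  rw [eval₂_finsetSum]
  refine Finset.sum_congr rfl fun l _ => ?_
  rw [eval₂_finsetSum]
  refine Finset.sum_congr rfl fun i _ => ?_
  rw [eval₂_monomial, Algebra.smul_def, ← mul_assoc]
  simp

/-- A lift of the difference quotient of `f` along the diagonal, times the `e`-th power of the
first coordinate, with balanced degrees in the two points. -/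
noncomputable def secant (f : k[X][X]) (d e : ℕ) : AdjoinRoot f ⊗[k] AdjoinRoot f :=
  ∑ j ∈ Finset.range (d + 1), ∑ i ∈ Finset.range (d + 1), (f.coeff j).coeff i •
    ∑ l ∈ Finset.range j,
      (AdjoinRoot.of f (X ^ min (e + i) (d - 1 - l)) * AdjoinRoot.root f ^ l) ⊗ₜ
      (AdjoinRoot.of f (X ^ (e + i - min (e + i) (d - 1 - l))) * AdjoinRoot.root f ^ (j - 1 - l))

theorem secant_mem_bidegreeFiltration (hf : IsPlaneModel f d) {e : ℕ} (he : e ≤ d - 1) :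
    secant f d e ∈ bidegreeFiltration f (d - 1) (d - 1) := by
  refine Submodule.sum_mem _ fun j hj => Submodule.sum_mem _ fun i hi => ?_
  by_cases hij : i + j ≤ d
  · refine Submodule.smul_mem _ _ (Submodule.sum_mem _ fun l hl => ?_)
    rw [Finset.mem_range] at hl hi hj
    exact bidegreeFiltration.tmul_mem
      (degreeFiltration.of_mul_root_pow_mem (by rw [natDegree_X_pow]; omega))
      (degreeFiltration.of_mul_root_pow_mem (by rw [natDegree_X_pow]; omega))
  · rw [hf.mem_boundedBideg i j (by omega), zero_smul]
    exact Submodule.zero_mem _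

theorem diffX_dvd_diffY_mul_secant (hf : IsPlaneModel f d) (e : ℕ) :
    diffX f ∣ diffY f * secant f d e := by
  rw [← Ideal.mem_span_singleton, ← Ideal.Quotient.eq_zero_iff_mem]
  set π := Ideal.Quotient.mkₐ k (Ideal.span {diffX f}) with hπ
  change π _ = 0
  let g₁ := π.comp (Algebra.TensorProduct.includeLeft : AdjoinRoot f →ₐ[k] _)
  let g₂ := π.comp (Algebra.TensorProduct.includeRight : AdjoinRoot f →ₐ[k] _)
  have hX : g₁ (AdjoinRoot.of f X) = g₂ (AdjoinRoot.of f X) := by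
    rw [← sub_eq_zero]
    change π _ - π _ = 0
    rw [← map_sub]
    exact Ideal.Quotient.eq_zero_iff_mem.2 (Ideal.mem_span_singleton_self _)
  have h1 := isCurvePoint_of_algHom g₁
  have h2 := isCurvePoint_of_algHom g₂
  rw [IsCurvePoint, boundedBideg.eval₂_eq_sum hf.mem_boundedBideg] at h1 h2
  have hmap : ∀ a b, π (a ⊗ₜ b) = g₁ a * g₂ b := by
    intro a b
    change _ = π _ * π _
    rw [← map_mul]
    simp
  have hdY : π (diffY f) = g₁ (AdjoinRoot.root f) - g₂ (AdjoinRoot.root f) := by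
    simp [diffY, hmap]
  rw [map_mul, hdY, secant, map_sum, Finset.mul_sum]
  rw [← hX] at h2
  set x := g₁ (AdjoinRoot.of f X)
  set y₁ := g₁ (AdjoinRoot.root f)
  set y₂ := g₂ (AdjoinRoot.root f)
  have hterm : ∀ j i : ℕ, (y₁ - y₂) * π ((f.coeff j).coeff i • ∑ l ∈ Finset.range j,
      (AdjoinRoot.of f (X ^ min (e + i) (d - 1 - l)) * AdjoinRoot.root f ^ l) ⊗ₜ[k]
      (AdjoinRoot.of f (X ^ (e + i - min (e + i) (d - 1 - l))) *
        AdjoinRoot.root f ^ (j - 1 - l))) =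
      x ^ e * ((f.coeff j).coeff i • (x ^ i * y₁ ^ j)) -
        x ^ e * ((f.coeff j).coeff i • (x ^ i * y₂ ^ j)) := by
    intro j i
    have h3 : ∀ l, π ((AdjoinRoot.of f (X ^ min (e + i) (d - 1 - l)) * AdjoinRoot.root f ^ l) ⊗ₜ[k]
      (AdjoinRoot.of f (X ^ (e + i - min (e + i) (d - 1 - l))) *
        AdjoinRoot.root f ^ (j - 1 - l))) = x ^ (e + i) * (y₁ ^ l * y₂ ^ (j - 1 - l)) := by
      intro l
      rw [hmap, map_mul, map_mul, map_pow, map_pow, map_pow, map_pow, map_pow, map_pow, ← hX]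
      have : x ^ (e + i) = x ^ min (e + i) (d - 1 - l) * x ^ (e + i - min (e + i) (d - 1 - l)) := by
        rw [← pow_add]
        congr 1
        omega
      rw [this]
      ring
    rw [map_smul, map_sum, Finset.sum_congr rfl fun l _ => h3 l, ← Finset.mul_sum,
      mul_smul_comm, mul_left_comm, mul_comm (y₁ - y₂), geom_sum₂_mul, mul_smul_comm,
      mul_smul_comm, ← smul_sub]
    congr 1
    ring
  have h4 : ∀ y, ∑ j ∈ Finset.range (d + 1), ∑ i ∈ Finset.range (d + 1),
      x ^ e * ((f.coeff j).coeff i • (x ^ i * y ^ j)) = x ^ e * ∑ j ∈ Finset.range (d + 1),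
      ∑ i ∈ Finset.range (d + 1), (f.coeff j).coeff i • (x ^ i * y ^ j) := by
    intro y
    simp only [Finset.mul_sum]
  have h5 : ∑ j ∈ Finset.range (d + 1), (y₁ - y₂) * π (∑ i ∈ Finset.range (d + 1),
      (f.coeff j).coeff i • ∑ l ∈ Finset.range j,
      (AdjoinRoot.of f (X ^ min (e + i) (d - 1 - l)) * AdjoinRoot.root f ^ l) ⊗ₜ[k]
      (AdjoinRoot.of f (X ^ (e + i - min (e + i) (d - 1 - l))) *
        AdjoinRoot.root f ^ (j - 1 - l))) =
      x ^ e * (∑ j ∈ Finset.range (d + 1), ∑ i ∈ Finset.range (d + 1),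
        (f.coeff j).coeff i • (x ^ i * y₁ ^ j)) -
      x ^ e * (∑ j ∈ Finset.range (d + 1), ∑ i ∈ Finset.range (d + 1),
        (f.coeff j).coeff i • (x ^ i * y₂ ^ j)) := by
    rw [← h4, ← h4, ← Finset.sum_sub_distrib]
    refine Finset.sum_congr rfl fun j _ => ?_
    rw [map_sum, Finset.mul_sum, ← Finset.sum_sub_distrib]
    exact Finset.sum_congr rfl fun i _ => hterm j i
  rw [h5, h1, h2, sub_self]

theorem graphHom_id_secant (hf : IsPlaneModel f d) (e : ℕ) :
    graphHom (AlgHom.id k _) (secant f d e) =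
      AdjoinRoot.of f X ^ e * AdjoinRoot.mk f (derivative f) := by
  have hder : derivative f = derivative (∑ l ∈ Finset.range (d + 1), ∑ i ∈ Finset.range (d + 1),
      monomial l (monomial i ((f.coeff l).coeff i))) :=
    congrArg _ (boundedBideg.eq_sum_monomial hf.mem_boundedBideg)
  rw [hder, secant, map_sum, derivative_sum, map_sum, Finset.mul_sum]
  refine Finset.sum_congr rfl fun j _ => ?_
  rw [map_sum, derivative_sum, map_sum, Finset.mul_sum]
  refine Finset.sum_congr rfl fun i _ => ?_
  rw [map_smul, map_sum, derivative_monomial]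
  have h3 : ∀ l ∈ Finset.range j, graphHom (AlgHom.id k _)
      ((AdjoinRoot.of f (X ^ min (e + i) (d - 1 - l)) * AdjoinRoot.root f ^ l) ⊗ₜ[k]
      (AdjoinRoot.of f (X ^ (e + i - min (e + i) (d - 1 - l))) *
        AdjoinRoot.root f ^ (j - 1 - l))) =
      AdjoinRoot.of f X ^ (e + i) * AdjoinRoot.root f ^ (j - 1) := by
    intro l hl
    rw [Finset.mem_range] at hl
    have h4 : AdjoinRoot.of f X ^ (e + i) = AdjoinRoot.of f X ^ min (e + i) (d - 1 - l) *
        AdjoinRoot.of f X ^ (e + i - min (e + i) (d - 1 - l)) := by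
      rw [← pow_add]
      congr 1
      omega
    have h5 : AdjoinRoot.root f ^ (j - 1) =
        AdjoinRoot.root f ^ l * AdjoinRoot.root f ^ (j - 1 - l) := by
      rw [← pow_add]
      congr 1
      omega
    rw [graphHom_tmul, h4, h5, AlgHom.id_apply, map_pow, map_pow]
    ring
  rw [Finset.sum_congr rfl h3, Finset.sum_const, Finset.card_range, Algebra.smul_def,
    nsmul_eq_mul, ← C_mul_X_pow_eq_monomial, ← C_mul_X_pow_eq_monomial]
  have h6 : algebraMap k (AdjoinRoot f) ((f.coeff j).coeff i) =
    AdjoinRoot.of f (C ((f.coeff j).coeff i)) := rfl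
  rw [h6]
  simp only [map_mul, map_pow, AdjoinRoot.mk_C, AdjoinRoot.mk_X, map_natCast]
  ring

end Secant

section ContactDimension

open scoped TensorProduct

theorem finrank_map_add_finrank_inf_ker {k M N : Type*} [Field k] [AddCommGroup M] [Module k M]
    [AddCommGroup N] [Module k N] (φ : M →ₗ[k] N) (V : Submodule k M) [FiniteDimensional k V] :
    Module.finrank k (V.map φ) + Module.finrank k ↥(V ⊓ LinearMap.ker φ) =
      Module.finrank k V := by
  rw [← LinearMap.finrank_range_add_finrank_ker (φ.domRestrict V), LinearMap.range_domRestrict,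
    LinearMap.ker_domRestrict, ← Submodule.map_comap_subtype, Submodule.finrank_map_subtype_eq]

theorem finrank_map_of_injective {k M N : Type*} [Field k] [AddCommGroup M] [Module k M]
    [AddCommGroup N] [Module k N] {φ : M →ₗ[k] N} (hφ : Function.Injective φ)
    (V : Submodule k M) : Module.finrank k (V.map φ) = Module.finrank k V :=
  (Submodule.equivMapOfInjective φ hφ V).finrank_eq.symm

variable {k : Type*} [Field k] {f : k[X][X]} {d m n j l : ℕ}

/-- Functions on pairs of points of bounded degree with high contact to the diagonal. -/
noncomputable def contactSpace (f : k[X][X]) (m n j : ℕ) :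
    Submodule k (AdjoinRoot f ⊗[k] AdjoinRoot f) :=
  bidegreeFiltration f m n ⊓ diagonalContact f j

theorem contactSpace.finiteDimensional (hf : IsPlaneModel f d) (m n j : ℕ) :
    FiniteDimensional k (contactSpace f m n j) := by
  have := bidegreeFiltration.finiteDimensional hf m n
  exact Submodule.finiteDimensional_of_le (inf_le_left : contactSpace f m n j ≤ _)

theorem contactSpace.mul_mem {m' n' j' : ℕ} {z w : AdjoinRoot f ⊗[k] AdjoinRoot f}
    (hz : z ∈ contactSpace f m n j) (hw : w ∈ contactSpace f m' n' j') :
    z * w ∈ contactSpace f (m + m') (n + n') (j + j') :=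
  ⟨bidegreeFiltration.mul_mem hz.1 hw.1, diagonalContact.mul_mem hz.2 hw.2⟩

theorem contactSpace.finrank_zero (hf : IsPlaneModel f d) (m n : ℕ) :
    Module.finrank k (contactSpace f m n 0) = countMonomials d m * countMonomials d n := by
  rw [← bidegreeFiltration.finrank_eq hf]
  have : contactSpace f m n 0 = bidegreeFiltration f m n :=
    inf_eq_left.2 fun z _ => diagonalContact.mem_zero z
  rw [this]

theorem exists_mem_contactSpace_eq_mul_pow (hf : IsPlaneModel f d) (j : ℕ) {e : ℕ}
    (he : e ≤ j * (d - 1)) :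
    ∃ w ∈ contactSpace f (j * (d - 1)) (j * (d - 1)) j, graphHom (AlgHom.id k _) w =
      AdjoinRoot.of f X ^ e * AdjoinRoot.mk f (derivative f) ^ j := by
  induction j generalizing e with
  | zero =>
    obtain rfl : e = 0 := by omega
    refine ⟨1, ⟨?_, diagonalContact.mem_zero _⟩, by simp⟩
    exact bidegreeFiltration.tmul_mem degreeFiltration.one_mem degreeFiltration.one_mem
  | succ j ih =>
    have h1 : (j + 1) * (d - 1) = j * (d - 1) + (d - 1) := by ring
    obtain ⟨e₁, e₂, rfl, he1, he2⟩ : ∃ e₁ e₂, e = e₁ + e₂ ∧ e₁ ≤ j * (d - 1) ∧ e₂ ≤ d - 1 :=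
      ⟨min e (j * (d - 1)), e - min e (j * (d - 1)), by omega, by omega, by omega⟩
    obtain ⟨w, hw, hwe⟩ := ih he1
    refine ⟨w * secant f d e₂, ?_, ?_⟩
    · rw [h1]
      exact contactSpace.mul_mem hw ⟨secant_mem_bidegreeFiltration hf he2,
        diagonalContact.mem_one_of_dvd (diffX_dvd_diffY_mul_secant hf e₂)⟩
    · rw [map_mul, hwe, graphHom_id_secant hf]
      ring

theorem exists_mem_contactSpace_eq (hf : IsPlaneModel f d) (hm : j * (d - 1) ≤ m)
    (hn : j * (d - 1) + (d - 1) ≤ n) (hl : l + j * (d - 1) ≤ m + n) {z : AdjoinRoot f}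
    (hz : z ∈ degreeFiltration f l) :
    ∃ w ∈ contactSpace f m n j,
      graphHom (AlgHom.id k _) w = AdjoinRoot.mk f (derivative f) ^ j * z := by
  let P : Submodule k (AdjoinRoot f) :=
    ((contactSpace f m n j).map (graphHom (AlgHom.id k (AdjoinRoot f))).toLinearMap).comap
      (LinearMap.mulLeft k (AdjoinRoot.mk f (derivative f) ^ j))
  suffices h : z ∈ P by
    obtain ⟨w, hw, hwz⟩ := h
    exact ⟨w, hw, hwz⟩
  obtain ⟨r, hr, hrd, rfl⟩ := degreeFiltration.exists_normalForm hf hz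
  rw [boundedBideg.eq_sum_monomial hr, map_sum]
  refine Submodule.sum_mem _ fun s hs => ?_
  rw [map_sum]
  refine Submodule.sum_mem _ fun i hi => ?_
  by_cases hc : (r.coeff s).coeff i = 0
  · simp [hc]
  have his : i + s ≤ l := by
    by_contra hcon
    exact hc (hr i s (by omega))
  have hsd : s < d := by
    by_contra hcon
    rw [coeff_eq_zero_of_degree_lt (hrd.trans_le ?_), coeff_zero] at hc
    · exact hc rfl
    · rw [degree_eq_natDegree hf.monic.ne_zero, hf.natDegree_eq]
      exact_mod_cast (by omega : d ≤ s)
  set p := j * (d - 1)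
  obtain ⟨i₁, i₂, e, rfl, h1, h2, h3⟩ : ∃ i₁ i₂ e, i = i₁ + i₂ + e ∧ i₁ + p ≤ m ∧
      i₂ + s + p ≤ n ∧ e ≤ p :=
    ⟨min i (m - p), min (i - min i (m - p)) (n - p - s),
      i - min i (m - p) - min (i - min i (m - p)) (n - p - s), by omega, by omega, by omega,
      by omega⟩
  obtain ⟨w, hw, hwe⟩ := exists_mem_contactSpace_eq_mul_pow hf j h3
  have h4 : AdjoinRoot.mk f (monomial s (monomial (i₁ + i₂ + e) ((r.coeff s).coeff (i₁ + i₂ + e))))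
      = (r.coeff s).coeff (i₁ + i₂ + e) •
        (AdjoinRoot.of f X ^ (i₁ + i₂ + e) * AdjoinRoot.root f ^ s) := by
    rw [← C_mul_X_pow_eq_monomial, ← C_mul_X_pow_eq_monomial, Algebra.smul_def]
    have h6 : algebraMap k (AdjoinRoot f) ((r.coeff s).coeff (i₁ + i₂ + e)) =
      AdjoinRoot.of f (C ((r.coeff s).coeff (i₁ + i₂ + e))) := rfl
    rw [h6]
    simp only [map_mul, map_pow, AdjoinRoot.mk_C, AdjoinRoot.mk_X]
    ring
  rw [h4]
  refine Submodule.smul_mem _ _ ⟨((AdjoinRoot.of f (X ^ i₁)) ⊗ₜ[k]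
    (AdjoinRoot.of f (X ^ i₂) * AdjoinRoot.root f ^ s)) * w, ?_, ?_⟩
  · have h7 := contactSpace.mul_mem (j := 0) ⟨bidegreeFiltration.tmul_mem
      (degreeFiltration.of_mem (f := f) (p := (X : k[X]) ^ i₁) (m := i₁) (by simp))
      (degreeFiltration.of_mul_root_pow_mem (f := f) (p := (X : k[X]) ^ i₂) (l := s)
        (m := i₂ + s) (by simp)), diagonalContact.mem_zero _⟩ hw
    rw [zero_add] at h7
    exact ⟨bidegreeFiltration.mono h1 h2 h7.1, h7.2⟩
  · change graphHom (AlgHom.id k (AdjoinRoot f)) _ = AdjoinRoot.mk f (derivative f) ^ j * _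
    rw [map_mul, hwe, graphHom_tmul, AlgHom.id_apply, map_pow, map_pow]
    ring

theorem contactSpace.finrank_succ [IsAlgClosed k] [IsDomain (AdjoinRoot f)]
    (hf : IsPlaneModel f d) (hd : 1 ≤ d) (hder : AdjoinRoot.mk f (derivative f) ≠ 0)
    (hm : (j + 1) * (d - 1) ≤ m + 1) (hn : (j + 1) * (d - 1) + (d - 1) ≤ n + 1)
    (hl : l + (j + 1) * (d - 1) ≤ m + n + 2) :
    Module.finrank k (contactSpace f m n j) + countMonomials d l ≤
      Module.finrank k (contactSpace f (m + 1) (n + 1) (j + 1)) := by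
  have := contactSpace.finiteDimensional hf (m + 1) (n + 1) (j + 1)
  rw [← finrank_map_add_finrank_inf_ker (graphHom (AlgHom.id k (AdjoinRoot f))).toLinearMap
    (contactSpace f (m + 1) (n + 1) (j + 1)), add_comm]
  refine add_le_add ?_ ?_
  · have hinj : Function.Injective
        (LinearMap.mulLeft k (AdjoinRoot.mk f (derivative f) ^ (j + 1))) :=
      fun a b hab => mul_left_cancel₀ (pow_ne_zero _ hder) hab
    rw [← degreeFiltration.finrank_eq hf l, ← finrank_map_of_injective hinj]
    refine Submodule.finrank_mono ?_
    rintro _ ⟨z, hz, rfl⟩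
    obtain ⟨w, hw, hwz⟩ := exists_mem_contactSpace_eq hf hm hn (by omega) hz
    exact ⟨w, hw, hwz⟩
  · have hinj : Function.Injective (LinearMap.mulLeft k (diffX f)) := by
      rw [injective_iff_map_eq_zero]
      exact fun z hz => eq_zero_of_diffX_mul_eq_zero hf hd hz
    rw [← finrank_map_of_injective hinj]
    refine Submodule.finrank_mono ?_
    rintro _ ⟨z, hz, rfl⟩
    refine ⟨?_, ?_⟩
    · have h1 := contactSpace.mul_mem ⟨bidegreeFiltration.diffX_mem, diagonalContact.diffX_mem⟩ hz
      rw [add_comm 1 m, add_comm 1 n, add_comm 1 j] at h1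
      exact h1
    · change graphHom _ (diffX f * z) = 0
      rw [map_mul, graphHom_diffX, AlgHom.id_apply, sub_self, zero_mul]

end ContactDimension

section PointContact

open scoped TensorProduct

variable {k : Type*} [Field k] {f : k[X][X]} {d m n j : ℕ}

theorem IsCurvePoint.exists_eq_add {x₀ y₀ : k} (h : IsCurvePoint f x₀ y₀) (z : AdjoinRoot f) :
    ∃ a b, z = algebraMap k _ (h.hom z) + AdjoinRoot.of f (X - C x₀) * a +
      (AdjoinRoot.root f - algebraMap k _ y₀) * b := by
  set I : Ideal (AdjoinRoot f) :=
    Ideal.span {AdjoinRoot.of f (X - C x₀), AdjoinRoot.root f - algebraMap k _ y₀} with hI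
  have hhom : (Ideal.Quotient.mkₐ k I) = (Ideal.Quotient.mkₐ k I).comp h.constHom := by
    refine AdjoinRoot.algHom_ext_of_X ?_ ?_
    · refine Ideal.Quotient.eq.2 (Ideal.subset_span (Or.inl ?_))
      change _ - h.constHom _ = _
      rw [IsCurvePoint.constHom_apply, IsCurvePoint.hom_of, map_sub, aeval_X]
      rfl
    · refine Ideal.Quotient.eq.2 (Ideal.subset_span (Or.inr ?_))
      change _ - h.constHom _ = _
      rw [IsCurvePoint.constHom_apply, IsCurvePoint.hom_root]
  have h1 : z - algebraMap k _ (h.hom z) ∈ I := Ideal.Quotient.eq.1 (DFunLike.congr_fun hhom z)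
  obtain ⟨a, b, hab⟩ := Ideal.mem_span_pair.1 h1
  refine ⟨a, b, ?_⟩
  linear_combination -hab

/-- Functions of bounded degree with high contact to the point `(x₀, y₀)`. -/
def pointContact (f : k[X][X]) (x₀ y₀ : k) (m j : ℕ) : Submodule k (AdjoinRoot f) where
  carrier := {z | z ∈ degreeFiltration f m ∧ ∀ s ≤ j, AdjoinRoot.of f (X - C x₀) ^ s ∣
    (AdjoinRoot.root f - algebraMap k _ y₀) ^ s * z}
  add_mem' := fun ha hb => ⟨Submodule.add_mem _ ha.1 hb.1, fun s hs => by
    rw [mul_add]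
    exact dvd_add (ha.2 s hs) (hb.2 s hs)⟩
  zero_mem' := ⟨Submodule.zero_mem _, fun s _ => by simp⟩
  smul_mem' := fun c z hz => ⟨Submodule.smul_mem _ _ hz.1, fun s hs => by
    rw [mul_smul_comm, Algebra.smul_def]
    exact (hz.2 s hs).mul_left _⟩

theorem pointContact_le (f : k[X][X]) (x₀ y₀ : k) (m j : ℕ) :
    pointContact f x₀ y₀ m j ≤ degreeFiltration f m := fun _ hz => hz.1

theorem of_X_sub_C_ne_zero (hf : IsPlaneModel f d) (hd : 1 ≤ d) (x₀ : k) :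
    AdjoinRoot.of f (X - C x₀) ≠ 0 := fun h =>
  X_sub_C_ne_zero x₀ (AdjoinRoot.of_injective_of_natDegree_pos (f := f)
    (by rw [hf.natDegree_eq]; omega) (h.trans (map_zero _).symm))

theorem IsCurvePoint.graphHom_constHom_mem_pointContact {x₀ y₀ : k} (h : IsCurvePoint f x₀ y₀)
    {z : AdjoinRoot f ⊗[k] AdjoinRoot f} (hz : z ∈ contactSpace f m n j) :
    graphHom h.constHom z ∈ pointContact f x₀ y₀ m j := by
  refine ⟨bidegreeFiltration.graphHom_constHom_mem h hz.1, fun s hs => ?_⟩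
  have h1 := map_dvd (graphHom h.constHom) (hz.2 s hs)
  rw [map_mul, map_pow, map_pow, graphHom_diffX, graphHom_diffY, h.constHom_apply,
    h.constHom_apply, h.hom_of, h.hom_root, aeval_X] at h1
  rw [map_sub]
  exact h1

theorem IsCurvePoint.finrank_pointContact_succ_le [IsDomain (AdjoinRoot f)]
    (hf : IsPlaneModel f d) (hd1 : 1 ≤ d) {x₀ y₀ : k} (h : IsCurvePoint f x₀ y₀)
    (hd : (derivative (f.map (evalRingHom x₀))).eval y₀ ≠ 0) (m j : ℕ) :
    Module.finrank k (pointContact f x₀ y₀ (m + 1) (j + 1)) ≤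
      Module.finrank k (pointContact f x₀ y₀ m j) + 1 := by
  have hfd : ∀ m j, FiniteDimensional k (pointContact f x₀ y₀ m j) := fun m j => by
    have := degreeFiltration.finiteDimensional hf m
    exact Submodule.finiteDimensional_of_le (pointContact_le f x₀ y₀ m j)
  have := hfd (m + 1) (j + 1)
  have := hfd m j
  obtain ⟨u, hu, hu0⟩ := h.exists_mul_root_sub_eq hd
  obtain ⟨a, b, hab⟩ := h.exists_eq_add u
  set ξ := AdjoinRoot.of f (X - C x₀) with hξ
  set η := AdjoinRoot.root f - algebraMap k _ y₀ with hη
  have hcu : IsUnit (algebraMap k (AdjoinRoot f) (h.hom u)) := hu0.isUnit.map _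
  rw [← finrank_map_add_finrank_inf_ker h.hom.toLinearMap, add_comm]
  refine add_le_add ?_ ((Submodule.finrank_le _).trans (Module.finrank_self k).le)
  have hξ0 : ξ ≠ 0 := of_X_sub_C_ne_zero hf hd1 x₀
  have hinj : Function.Injective (LinearMap.mulLeft k ξ) := fun a b hab =>
    mul_left_cancel₀ hξ0 hab
  rw [← finrank_map_of_injective hinj (pointContact f x₀ y₀ m j)]
  refine Submodule.finrank_mono ?_
  rintro R ⟨⟨hR, hRs⟩, hR0⟩
  replace hR0 : h.hom R = 0 := hR0
  have hR1 : ξ ∣ R := by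
    rw [← hcu.dvd_mul_left]
    obtain ⟨a', b', hab'⟩ := h.exists_eq_add R
    rw [hR0, map_zero, zero_add] at hab'
    have h1 : algebraMap k (AdjoinRoot f) (h.hom u) * R =
      ξ * (u * a' - a * R) + b' * (u * η) - b * (η ^ 1 * R) := by
      linear_combination -R * hab + u * hab'
    rw [h1]
    refine dvd_sub (dvd_add (dvd_mul_right _ _) (hu.mul_left _)) (Dvd.dvd.mul_left ?_ _)
    have h2 := hRs 1 (by omega)
    rwa [pow_one] at h2
  obtain ⟨R', rfl⟩ := hR1
  refine ⟨R', ⟨(degreeFiltration.of_mul_mem hf (X_sub_C_ne_zero x₀) hR (by simp)).1, ?_⟩, rfl⟩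
  have h1 : ∀ s ≤ j, ξ ^ s ∣ η ^ (s + 1) * R' := by
    intro s hs
    have h2 := hRs (s + 1) (by omega)
    rw [pow_succ' ξ, mul_left_comm] at h2
    exact (mul_dvd_mul_iff_left hξ0).1 h2
  intro s hs
  induction s with
  | zero => simp
  | succ s ih =>
    rw [← hcu.dvd_mul_left]
    have h2 : algebraMap k (AdjoinRoot f) (h.hom u) * (η ^ (s + 1) * R') =
        (u * η) * (η ^ s * R') - a * η * (ξ * (η ^ s * R')) - b * (η ^ (s + 1 + 1) * R') := by
      linear_combination -η ^ (s + 1) * R' * hab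
    rw [h2]
    refine dvd_sub (dvd_sub ?_ (Dvd.dvd.mul_left ?_ _)) (Dvd.dvd.mul_left (h1 _ hs) _)
    · rw [pow_succ']
      exact mul_dvd_mul hu (ih (by omega))
    · rw [pow_succ']
      exact mul_dvd_mul_left _ (ih (by omega))

theorem IsCurvePoint.finrank_pointContact_le [IsDomain (AdjoinRoot f)]
    (hf : IsPlaneModel f d) (hd1 : 1 ≤ d) {x₀ y₀ : k} (h : IsCurvePoint f x₀ y₀)
    (hd : (derivative (f.map (evalRingHom x₀))).eval y₀ ≠ 0) (m j : ℕ) :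
    Module.finrank k (pointContact f x₀ y₀ (m + j) j) ≤ countMonomials d m + j := by
  induction j with
  | zero =>
    have := degreeFiltration.finiteDimensional hf m
    rw [← degreeFiltration.finrank_eq hf m]
    exact Submodule.finrank_mono (pointContact_le f x₀ y₀ m 0)
  | succ j ih =>
    have h1 := h.finrank_pointContact_succ_le hf hd1 hd (m + j) j
    rw [← add_assoc]
    omega

end PointContact

section Frobenius

open scoped TensorProduct

variable {K k : Type*} [Field K] [Fintype K] [Field k] [Algebra K k]

theorem eval₂_aeval_pow_card {B : Type*} [CommRing B] [Algebra K B] [Algebra k B]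
    [IsScalarTower K k B] (r : K[X][X]) (u v : B) :
    (r.map (mapRingHom (algebraMap K k))).eval₂
      (aeval (u ^ Fintype.card K) : k[X] →ₐ[k] B) (v ^ Fintype.card K) =
    (r.map (mapRingHom (algebraMap K k))).eval₂ (aeval u : k[X] →ₐ[k] B) v ^ Fintype.card K := by
  have h1 : ∀ u : B, ((aeval u : k[X] →ₐ[k] B) : k[X] →+* B).comp (mapRingHom (algebraMap K k)) =
      ((aeval u : K[X] →ₐ[K] B) : K[X] →+* B) := by
    intro u
    ext x
    · simp [← IsScalarTower.algebraMap_apply]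
    · simp
  have h2 : (((FiniteField.frobeniusAlgHom K B).comp (aeval u) : K[X] →ₐ[K] B) : K[X] →+* B) =
      ((aeval (u ^ Fintype.card K) : K[X] →ₐ[K] B) : K[X] →+* B) := by
    congr 1
    ext
    simp
  rw [eval₂_map, eval₂_map, h1, h1, ← h2]
  exact (hom_eval₂ r ((aeval u : K[X] →ₐ[K] B) : K[X] →+* B)
    ((FiniteField.frobeniusAlgHom K B : B →ₐ[K] B) : B →+* B) v).symm

theorem isCurvePoint_pow_card_iff {B : Type*} [CommRing B] [IsReduced B] [Algebra K B]
    [Algebra k B] [IsScalarTower K k B] {f₀ : K[X][X]} {u v : B} :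
    IsCurvePoint (f₀.map (mapRingHom (algebraMap K k))) (u ^ Fintype.card K)
      (v ^ Fintype.card K) ↔ IsCurvePoint (f₀.map (mapRingHom (algebraMap K k))) u v := by
  rw [IsCurvePoint, IsCurvePoint, eval₂_aeval_pow_card, pow_eq_zero_iff Fintype.card_ne_zero]

theorem sub_pow_card {B : Type*} [CommRing B] [Algebra K B] (u v : B) :
    (u - v) ^ Fintype.card K = u ^ Fintype.card K - v ^ Fintype.card K :=
  map_sub (FiniteField.frobeniusAlgHom K B) u v

variable {f₀ : K[X][X]} {d m : ℕ}

local notation "base" => Polynomial.map (Polynomial.mapRingHom (algebraMap K k)) f₀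

theorem IsCurvePoint.exists_pow_card_eq [IsAlgClosed k] {x₀ y₀ : k}
    (h : IsCurvePoint base x₀ y₀) :
    ∃ x₁ y₁, x₁ ^ Fintype.card K = x₀ ∧ y₁ ^ Fintype.card K = y₀ ∧ IsCurvePoint base x₁ y₁ := by
  obtain ⟨x₁, rfl⟩ := IsAlgClosed.exists_pow_nat_eq x₀ (Fintype.card_pos (α := K))
  obtain ⟨y₁, rfl⟩ := IsAlgClosed.exists_pow_nat_eq y₀ (Fintype.card_pos (α := K))
  exact ⟨x₁, y₁, rfl, rfl, isCurvePoint_pow_card_iff.1 h⟩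

/-- Products with the Frobenius preserve linear independence in small degree. -/
theorem eq_zero_of_sum_mul_frobenius_eq_zero [IsAlgClosed k] [IsDomain (AdjoinRoot base)]
    (hf : IsPlaneModel base d) (hd : 1 ≤ d)
    (hder : AdjoinRoot.mk base (derivative base) ≠ 0)
    {φ : AdjoinRoot base →ₐ[k] AdjoinRoot base}
    (hφX : φ (AdjoinRoot.of base X) = AdjoinRoot.of base X ^ Fintype.card K)
    (hφY : φ (AdjoinRoot.root base) = AdjoinRoot.root base ^ Fintype.card K)
    {ι : Type*} {g e : ι → AdjoinRoot base} (hg : LinearIndependent k g)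
    (hgm : ∀ i, g i ∈ degreeFiltration base m) (hm : d * m < Fintype.card K)
    {s : Finset ι} (h : ∑ i ∈ s, g i * φ (e i) = 0) {i : ι} (hi : i ∈ s) : e i = 0 := by
  by_contra hei
  obtain ⟨x₀, y₀, hQ', hne⟩ := IsCurvePoint.exists_hom_ne_zero hf hd (mul_ne_zero hder hei)
  rw [map_mul] at hne
  obtain ⟨x₁, y₁, rfl, rfl, hQ⟩ := hQ'.exists_pow_card_eq
  have hder1 : (derivative ((base).map (evalRingHom x₁))).eval y₁ ≠ 0 := by
    have h1 := left_ne_zero_of_mul hne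
    rw [IsCurvePoint.hom_mk, derivative_map, eval₂_aeval_pow_card, ← derivative_map,
      ← IsCurvePoint.hom_mk hQ, IsCurvePoint.hom_mk_eq_eval] at h1
    rw [derivative_map]
    exact fun h2 => h1 (by rw [h2, zero_pow Fintype.card_ne_zero])
  obtain ⟨u, hu, hu0⟩ := hQ.exists_mul_root_sub_eq hder1
  set q := Fintype.card K with hq
  set ξ := AdjoinRoot.of base (X - C x₁) with hξ
  set η := AdjoinRoot.root base - algebraMap k _ y₁ with hη
  let I : Ideal (AdjoinRoot base) :=
    Submodule.comap (LinearMap.mulLeft (AdjoinRoot base) (u ^ q)) (Ideal.span {ξ ^ q})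
  have hI : ∀ z, z ∈ I ↔ ξ ^ q ∣ u ^ q * z := fun z => Ideal.mem_span_singleton
  have hhom : (Ideal.Quotient.mkₐ k I).comp φ = (Ideal.Quotient.mkₐ k I).comp hQ'.constHom := by
    refine AdjoinRoot.algHom_ext_of_X ?_ ?_
    · refine Ideal.Quotient.eq.2 ?_
      change φ _ - hQ'.constHom _ ∈ I
      rw [hφX, hQ'.constHom_apply, IsCurvePoint.hom_of, aeval_X, map_pow, ← sub_pow_card, hI]
      have h1 : AdjoinRoot.of base X - algebraMap k _ x₁ = ξ := by
        rw [hξ, map_sub]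
        rfl
      rw [h1]
      exact dvd_mul_left _ _
    · refine Ideal.Quotient.eq.2 ?_
      change φ _ - hQ'.constHom _ ∈ I
      rw [hφY, hQ'.constHom_apply, IsCurvePoint.hom_root, map_pow, ← sub_pow_card, hI, ← mul_pow]
      exact pow_dvd_pow_of_dvd hu q
  have hmod : ∀ z, algebraMap k _ (hQ'.hom z) - φ z ∈ I := fun z =>
    Ideal.Quotient.eq.1 (DFunLike.congr_fun hhom z).symm
  set G := ∑ i ∈ s, hQ'.hom (e i) • g i with hG
  have hGI : G ∈ I := by
    have h1 : G = ∑ i ∈ s, g i * (algebraMap k _ (hQ'.hom (e i)) - φ (e i)) := by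
      simp only [mul_sub, Finset.sum_sub_distrib, h, sub_zero, hG, Algebra.smul_def, mul_comm]
    rw [h1]
    exact Ideal.sum_mem _ fun i _ => Ideal.mul_mem_left _ _ (hmod _)
  have hG0 : G ≠ 0 := fun h0 =>
    right_ne_zero_of_mul hne (linearIndependent_iff'.1 hg _ _ h0 i hi)
  have hGm : G ∈ degreeFiltration base m :=
    Submodule.sum_mem _ fun i _ => Submodule.smul_mem _ _ (hgm i)
  obtain ⟨n, hn, hnd, w, hw⟩ := exists_mul_eq_of_of_mem_degreeFiltration hf hd hGm hG0
  have hnI : AdjoinRoot.of base n ∈ I := hw ▸ Ideal.mul_mem_right _ _ hGI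
  obtain ⟨n₁, hn₁, hndvd⟩ := exists_eq_pow_rootMultiplicity_mul_and_not_dvd n hn x₁
  set t := rootMultiplicity x₁ n
  have ht : t < q := by
    refine lt_of_le_of_lt ?_ (hnd.trans_lt hm)
    have h1 := natDegree_le_of_dvd (pow_rootMultiplicity_dvd n x₁) hn
    rwa [natDegree_pow, natDegree_X_sub_C, mul_one] at h1
  rw [hI, hn₁, map_mul, map_pow, ← hξ, mul_left_comm, ← Nat.add_sub_cancel' ht.le, pow_add,
    mul_dvd_mul_iff_left (pow_ne_zero _ (of_X_sub_C_ne_zero hf hd x₁))] at hnI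
  have h1 := map_dvd hQ.hom ((dvd_pow_self ξ (by omega)).trans hnI)
  rw [hξ, IsCurvePoint.hom_of, map_mul, IsCurvePoint.hom_of] at h1
  simp only [map_sub, aeval_X, aeval_C, Algebra.algebraMap_self, RingHom.id_apply, sub_self,
    zero_dvd_iff, mul_eq_zero, map_pow] at h1
  rcases h1 with h1 | h1
  · exact hu0 (eq_zero_of_pow_eq_zero h1)
  · exact hndvd (dvd_iff_isRoot.2 (by simpa [coe_aeval_eq_eval] using h1))

end Frobenius

section RationalPoints

open scoped TensorProduct

variable {K k : Type*} [Field K] [Fintype K] [Field k] [Algebra K k]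

theorem X_pow_card_sub_X_dvd {p : K[X]} (h : ∀ a, p.eval a = 0) :
    (X ^ Fintype.card K - X : K[X]) ∣ p := by
  have hm : (X ^ Fintype.card K - X : K[X]).Monic :=
    monic_X_pow_sub (by rw [degree_X]; exact_mod_cast Fintype.one_lt_card)
  rw [← modByMonic_eq_zero_iff_dvd hm]
  by_contra hne
  have h1 : ∀ a, (p %ₘ (X ^ Fintype.card K - X)).eval a = 0 := by
    intro a
    have := congrArg (eval a) (modByMonic_add_div p (X ^ Fintype.card K - X : K[X]))
    simpa [h, FiniteField.pow_card] using this
  have h2 := card_le_degree_of_subset_roots (p := p %ₘ (X ^ Fintype.card K - X))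
    (Z := Finset.univ) (fun a _ => by simpa [hne] using h1 a)
  have h3 := natDegree_modByMonic_lt p hm (fun h => by
    have := congrArg natDegree h
    rw [FiniteField.X_pow_card_sub_X_natDegree_eq K Fintype.one_lt_card, natDegree_one] at this
    exact Fintype.card_ne_zero this)
  rw [FiniteField.X_pow_card_sub_X_natDegree_eq K Fintype.one_lt_card] at h3
  rw [Finset.card_univ] at h2
  omega

theorem mem_span_of_forall_eval_eq_zero {r : K[X][X]}
    (h : ∀ a b, (r.map (evalRingHom a)).eval b = 0) :
    r ∈ Ideal.span {C (X ^ Fintype.card K - X : K[X]), (X ^ Fintype.card K - X : K[X][X])} := by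
  have hdeg : (X ^ Fintype.card K - X : K[X][X]).natDegree = Fintype.card K :=
    natDegree_sub_eq_left_of_natDegree_lt (by
      rw [natDegree_X, natDegree_X_pow]; exact Fintype.one_lt_card) |>.trans (natDegree_X_pow _)
  have hm : (X ^ Fintype.card K - X : K[X][X]).Monic :=
    monic_X_pow_sub (by rw [degree_X]; exact_mod_cast Fintype.one_lt_card)
  rw [Ideal.mem_span_pair]
  set R := r %ₘ (X ^ Fintype.card K - X) with hR
  have hRdeg : R.natDegree < Fintype.card K := by
    rw [← hdeg]
    exact natDegree_modByMonic_lt r hm (fun h => by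
      have := congrArg natDegree h
      rw [hdeg, natDegree_one] at this
      exact Fintype.card_ne_zero this)
  have h1 : ∀ a, R.map (evalRingHom a) = 0 := by
    intro a
    have h2 : ∀ b, (R.map (evalRingHom a)).eval b = 0 := by
      intro b
      have h3 := congrArg (fun s => (s.map (evalRingHom a)).eval b)
        (modByMonic_add_div r (X ^ Fintype.card K - X : K[X][X]))
      simpa [h, FiniteField.pow_card] using h3
    refine eq_zero_of_natDegree_lt_card_of_eval_eq_zero' _ Finset.univ (fun b _ => h2 b) ?_
    rw [Finset.card_univ]
    exact natDegree_map_le.trans_lt hRdeg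
  obtain ⟨s, hs⟩ : C (X ^ Fintype.card K - X : K[X]) ∣ R := by
    rw [C_dvd_iff_dvd_coeff]
    intro i
    refine X_pow_card_sub_X_dvd fun a => ?_
    simpa using congrArg (fun s => s.coeff i) (h1 a)
  refine ⟨s, r /ₘ (X ^ Fintype.card K - X), ?_⟩
  rw [mul_comm s, ← hs, mul_comm]
  exact modByMonic_add_div r _

variable {f₀ : K[X][X]} {d m : ℕ}

local notation "base" => Polynomial.map (Polynomial.mapRingHom (algebraMap K k)) f₀

theorem mk_derivative_mem_span
    (h : ∀ a b, (f₀.map (evalRingHom a)).eval b = 0 →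
      ((derivative f₀).map (evalRingHom a)).eval b = 0) :
    AdjoinRoot.mk base (derivative base) ∈ Ideal.span
      {AdjoinRoot.of base X ^ Fintype.card K - AdjoinRoot.of base X,
        AdjoinRoot.root base ^ Fintype.card K - AdjoinRoot.root base} := by
  have hq := Fintype.one_lt_card (α := K)
  have h1 : derivative f₀ - derivative f₀ * f₀ ^ (Fintype.card K - 1) ∈
      Ideal.span {C (X ^ Fintype.card K - X : K[X]), (X ^ Fintype.card K - X : K[X][X])} := by
    refine mem_span_of_forall_eval_eq_zero fun a b => ?_
    by_cases h0 : (f₀.map (evalRingHom a)).eval b = 0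
    · simp [h0, h a b h0]
    · simp [FiniteField.pow_card_sub_one_eq_one _ h0]
  let ρ : K[X][X] →+* AdjoinRoot base :=
    (AdjoinRoot.mk base).comp (mapRingHom (mapRingHom (algebraMap K k)))
  have h2 := Ideal.mem_map_of_mem ρ h1
  rw [Ideal.map_span, Set.image_pair] at h2
  have hf : ρ f₀ = 0 := AdjoinRoot.mk_self
  have hd : ρ (derivative f₀) = AdjoinRoot.mk base (derivative base) := by
    rw [derivative_map]
    rfl
  have hX : ρ (C (X ^ Fintype.card K - X)) =
      AdjoinRoot.of base X ^ Fintype.card K - AdjoinRoot.of base X := by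
    simp [ρ]
  have hY : ρ (X ^ Fintype.card K - X) =
      AdjoinRoot.root base ^ Fintype.card K - AdjoinRoot.root base := by
    simp [ρ]
  rwa [hX, hY, map_sub, map_mul, map_pow, hf, hd, zero_pow (by omega), mul_zero, sub_zero] at h2

theorem pow_dvd_pow_mul_of_mem_span {A : Type*} [CommRing A] {a b D z : A} {j : ℕ}
    (hD : D ∈ Ideal.span {a, b}) (hz : ∀ s ≤ j, a ^ s ∣ b ^ s * z) : a ^ j ∣ D ^ j * z := by
  obtain ⟨α, β, rfl⟩ := Ideal.mem_span_pair.1 hD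
  rw [add_pow, Finset.sum_mul]
  refine Finset.dvd_sum fun i hi => ?_
  rw [Finset.mem_range] at hi
  have h1 : (α * a) ^ i * (β * b) ^ (j - i) * (j.choose i : A) * z =
      α ^ i * β ^ (j - i) * j.choose i * (a ^ i * (b ^ (j - i) * z)) := by
    ring
  rw [h1]
  refine Dvd.dvd.mul_left ?_ _
  have h2 : a ^ j = a ^ i * a ^ (j - i) := by
    rw [← pow_add]
    congr 1
    omega
  rw [h2]
  exact mul_dvd_mul_left _ (hz _ (by omega))

theorem pow_dvd_pow_mul_graphHom {f : k[X][X]} {D : AdjoinRoot f} {q j : ℕ}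
    (hD : D ∈ Ideal.span {AdjoinRoot.of f X ^ q - AdjoinRoot.of f X,
      AdjoinRoot.root f ^ q - AdjoinRoot.root f})
    {φ : AdjoinRoot f →ₐ[k] AdjoinRoot f} (hφX : φ (AdjoinRoot.of f X) = AdjoinRoot.of f X ^ q)
    (hφY : φ (AdjoinRoot.root f) = AdjoinRoot.root f ^ q)
    {z : AdjoinRoot f ⊗[k] AdjoinRoot f} (hz : z ∈ diagonalContact f j) :
    (AdjoinRoot.of f X ^ q - AdjoinRoot.of f X) ^ j ∣ D ^ j * graphHom φ z := by
  refine pow_dvd_pow_mul_of_mem_span hD fun s hs => ?_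
  have h1 := map_dvd (graphHom φ) (hz s hs)
  rw [map_mul, map_pow, map_pow, graphHom_diffX, graphHom_diffY, hφX, hφY,
    ← neg_sub, ← neg_sub (AdjoinRoot.root f ^ q), neg_pow, neg_pow (AdjoinRoot.root f ^ q - _),
    mul_assoc] at h1
  have h2 : IsUnit ((-1 : AdjoinRoot f) ^ s) := isUnit_one.neg.pow s
  rwa [h2.mul_left_dvd, h2.dvd_mul_left] at h1

end RationalPoints

section Vanishing

universe u

open scoped TensorProduct

variable {k : Type*} [Field k] {f : k[X][X]} {d m n j : ℕ}

theorem exists_mem_contactSpace_graphHom_constHom_eq_zero [IsDomain (AdjoinRoot f)]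
    (hf : IsPlaneModel f d) (hd : 1 ≤ d) {ι : Type*} [Fintype ι] {x y : ι → k}
    (h : ∀ i, IsCurvePoint f (x i) (y i))
    (hder : ∀ i, (derivative (f.map (evalRingHom (x i)))).eval (y i) ≠ 0)
    (hcard : Fintype.card ι * (countMonomials d m + j) <
      Module.finrank k (contactSpace f (m + j) n j)) :
    ∃ R ∈ contactSpace f (m + j) n j, R ≠ 0 ∧ ∀ i, graphHom (h i).constHom R = 0 := by
  have hfd : ∀ x₀ y₀ m j, FiniteDimensional k (pointContact f x₀ y₀ m j) := fun x₀ y₀ m j => by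
    have := degreeFiltration.finiteDimensional hf m
    exact Submodule.finiteDimensional_of_le (pointContact_le f x₀ y₀ m j)
  have := contactSpace.finiteDimensional hf (m + j) n j
  let Φ : contactSpace f (m + j) n j →ₗ[k] ∀ i, pointContact f (x i) (y i) (m + j) j :=
    LinearMap.pi fun i => LinearMap.codRestrict _
      ((graphHom (h i).constHom).toLinearMap.domRestrict _)
      fun z => (h i).graphHom_constHom_mem_pointContact z.2
  have hker : LinearMap.ker Φ ≠ ⊥ := by
    refine LinearMap.ker_ne_bot_of_finrank_lt (lt_of_le_of_lt ?_ hcard)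
    rw [Module.finrank_pi_fintype, ← Finset.card_univ, ← smul_eq_mul]
    exact Finset.sum_le_card_nsmul _ _ _ fun i _ => (h i).finrank_pointContact_le hf hd (hder i) m j
  obtain ⟨R, hR, hR0⟩ := Submodule.exists_mem_ne_zero_of_ne_bot hker
  refine ⟨R, R.2, fun h0 => hR0 (Subtype.ext h0), fun i => ?_⟩
  exact congrArg Subtype.val (congrFun (LinearMap.mem_ker.1 hR) i)

theorem exists_eq_of_prod_mul [IsAlgClosed k] (hf : IsPlaneModel f d) {X₀ : Finset k}
    (hX₀ : ∀ x ∈ X₀, ∀ y, (f.map (evalRingHom x)).eval y = 0 →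
      (derivative (f.map (evalRingHom x))).eval y ≠ 0)
    {e : AdjoinRoot f} (he : ∀ x ∈ X₀, ∀ y (h : IsCurvePoint f x y), h.hom e = 0) :
    ∃ e', e = AdjoinRoot.of f (∏ x ∈ X₀, (X - C x)) * e' := by
  classical
  obtain ⟨r, hr, rfl⟩ := degreeFiltration.exists_normalForm' hf.monic e
  suffices h : C (∏ x ∈ X₀, (X - C x)) ∣ r by
    obtain ⟨s, rfl⟩ := h
    exact ⟨AdjoinRoot.mk f s, by rw [map_mul, AdjoinRoot.mk_C]⟩
  rw [C_dvd_iff_dvd_coeff]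
  intro i
  refine Finset.prod_dvd_of_coprime (fun x _ y _ hxy => ?_) fun x hx => ?_
  · exact isCoprime_X_sub_C_of_isUnit_sub (sub_ne_zero.2 hxy).isUnit
  have h1 : r.map (evalRingHom x) = 0 := by
    have hmon := hf.monic.map (evalRingHom x)
    refine eq_zero_of_degree_lt_of_eval_finset_eq_zero
      (f.map (evalRingHom x)).roots.toFinset ?_ fun y hy => ?_
    · rw [card_roots_toFinset_of_derivative_ne_zero hmon.ne_zero (hX₀ x hx),
        ← degree_eq_natDegree hmon.ne_zero, hf.monic.degree_map]
      exact degree_map_le.trans_lt hr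
    · rw [Multiset.mem_toFinset, mem_roots hmon.ne_zero] at hy
      rw [← IsCurvePoint.hom_mk_eq_eval (isCurvePoint_iff_eval.2 hy)]
      exact he x hx y _
  rw [dvd_iff_isRoot]
  simpa using congrArg (fun s => s.coeff i) h1

theorem mk_derivative_mem_degreeFiltration (hf : IsPlaneModel f d) (hd : 1 ≤ d) :
    AdjoinRoot.mk f (derivative f) ∈ degreeFiltration f (d - 1) := by
  refine degreeFiltration.mk_mem fun i l hil => ?_
  rw [coeff_derivative, ← Nat.cast_succ, ← map_natCast C, coeff_mul_C,
    hf.mem_boundedBideg i (l + 1) (by omega), zero_mul]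

theorem IsCurvePoint.hom_mem_degreeFiltration {q : ℕ}
    (h : IsCurvePoint f (AdjoinRoot.of f X ^ q) (AdjoinRoot.root f ^ q)) {z : AdjoinRoot f}
    (hz : z ∈ degreeFiltration f m) : h.hom z ∈ degreeFiltration f (q * m) := by
  obtain ⟨r, hr, rfl⟩ := degreeFiltration.mem_iff.1 hz
  rw [IsCurvePoint.hom_mk, boundedBideg.eval₂_eq_sum hr]
  refine Submodule.sum_mem _ fun l _ => Submodule.sum_mem _ fun i _ => ?_
  by_cases hil : i + l ≤ m
  · refine Submodule.smul_mem _ _ ?_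
    rw [← pow_mul, ← pow_mul, ← map_pow]
    refine degreeFiltration.of_mul_root_pow_mem ?_
    rw [natDegree_X_pow, ← mul_add]
    exact Nat.mul_le_mul_left _ hil
  · rw [hr i l (by omega), zero_smul]
    exact Submodule.zero_mem _

theorem isCoprime_X_sub_C_of_eval_ne_zero {x : k} {p : k[X]} (h : p.eval x ≠ 0) :
    IsCoprime (X - C x) p :=
  (irreducible_X_sub_C x).coprime_iff_not_dvd.2 fun hdvd => h (dvd_iff_isRoot.1 hdvd)

theorem isCoprime_X_pow_sub_C {x : k} {q : ℕ} (h : x ^ q ≠ x) :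
    IsCoprime (X ^ q - C x : k[X]) (X ^ q - X : k[X]) := by
  obtain ⟨a, b, hab⟩ := isCoprime_X_sub_C_of_eval_ne_zero (x := x) (p := X ^ q - C x)
    (by simpa [sub_eq_zero] using h)
  exact ⟨a + b, -a, by linear_combination hab⟩

theorem isCoprime_comp_X_pow {X₀ : Finset k} {q : ℕ} (h : ∀ x ∈ X₀, x ^ q ≠ x) :
    IsCoprime ((∏ x ∈ X₀, (X - C x)).comp (X ^ q)) (X ^ q - X : k[X]) := by
  rw [prod_comp]
  refine IsCoprime.prod_left fun x hx => ?_
  rw [sub_comp, X_comp, C_comp]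
  exact isCoprime_X_pow_sub_C (h x hx)

theorem exists_eq_sum_tmul {k : Type u} [Field k] {f : k[X][X]} {m n : ℕ}
    {R : AdjoinRoot f ⊗[k] AdjoinRoot f} (hR : R ∈ bidegreeFiltration f m n) :
    ∃ (ι : Type u) (s : Finset ι) (g e : ι → AdjoinRoot f), LinearIndependent k g ∧
      (∀ i, g i ∈ degreeFiltration f m) ∧ (∀ i, e i ∈ degreeFiltration f n) ∧
      R = ∑ i ∈ s, g i ⊗ₜ e i := by
  obtain ⟨w, rfl⟩ := hR
  let b := Module.Basis.ofVectorSpace k (degreeFiltration f m)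
  obtain ⟨c, rfl⟩ := TensorProduct.eq_repr_basis_left b w
  refine ⟨_, c.support, fun i => b i, fun i => c i, ?_, fun i => (b i).2, fun i => (c i).2, ?_⟩
  · exact b.linearIndependent.map' (degreeFiltration f m).subtype (Submodule.ker_subtype _)
  · rw [Finsupp.sum, map_sum]
    rfl

end Vanishing

section PlaneTheorem

open scoped TensorProduct

theorem sum_le_finrank_contactSpace {k : Type*} [Field k] [IsAlgClosed k] {f : k[X][X]}
    [IsDomain (AdjoinRoot f)] {d : ℕ} (hf : IsPlaneModel f d) (hd : 1 ≤ d)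
    (hder : AdjoinRoot.mk f (derivative f) ≠ 0) (a b : ℕ) (l : ℕ → ℕ) (j : ℕ)
    (ha : ∀ i < j, (i + 1) * (d - 1) ≤ a + i + 1)
    (hb : ∀ i < j, (i + 1) * (d - 1) + (d - 1) ≤ b + i + 1)
    (hl : ∀ i < j, l i + (i + 1) * (d - 1) ≤ a + b + 2 * (i + 1)) :
    countMonomials d a * countMonomials d b + ∑ i ∈ Finset.range j, countMonomials d (l i) ≤
      Module.finrank k (contactSpace f (a + j) (b + j) j) := by
  induction j with
  | zero => simp [contactSpace.finrank_zero hf]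
  | succ j ih =>
    rw [Finset.sum_range_succ, ← add_assoc]
    refine (add_le_add_left (ih (fun i hi => ha i (by omega)) (fun i hi => hb i (by omega))
      fun i hi => hl i (by omega)) _).trans ?_
    refine contactSpace.finrank_succ hf hd hder (ha j (by omega)) (hb j (by omega)) ?_
    have := hl j (by omega)
    omega

theorem card_mul_lt_sum_countMonomials (c : ℕ) {p a b : ℕ} (hp : p = (c + 2) * (c + 1))
    (ha : a = p * c) (hb : b = p * c + (c + 2)) :
    (c + 2) * (b + 1) * (countMonomials (c + 2) a + p) <
      countMonomials (c + 2) a * countMonomials (c + 2) b +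
        ∑ i ∈ Finset.range p, countMonomials (c + 2) (a + b + 2 * (i + 1) - (i + 1) * (c + 1)) := by
  have hac : c ≤ a := by
    rw [ha, hp]
    nlinarith [mul_nonneg (Nat.zero_le c) (Nat.zero_le c)]
  have h1 := two_mul_countMonomials_add (d := c + 2) (m := a) (by omega)
  have h2 := two_mul_countMonomials_add (d := c + 2) (m := b) (by omega)
  have h3 : ∀ n ≤ p, 2 * (∑ i ∈ Finset.range n,
      countMonomials (c + 2) (a + b + 2 * (i + 1) - (i + 1) * (c + 1)) : ℤ) =
      n * (c + 2) * (2 * (a + b) + 1 - c) + (c + 2) * (1 - c) * n * (n + 1) := by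
    intro n hn
    induction n with
    | zero => simp
    | succ n ih =>
      have h4 : (n + 1) * (c + 1) ≤ a + (n + 1) := by
        rw [ha]
        nlinarith
      have h5 := two_mul_countMonomials_add (d := c + 2)
        (m := a + b + 2 * (n + 1) - (n + 1) * (c + 1)) (by omega)
      rw [Finset.sum_range_succ, mul_add, ih (by omega)]
      zify [show (n + 1) * (c + 1) ≤ a + b + 2 * (n + 1) by omega] at h5
      push_cast
      linear_combination h5
  have h3p := h3 p le_rfl
  set S := ∑ i ∈ Finset.range p, countMonomials (c + 2) (a + b + 2 * (i + 1) - (i + 1) * (c + 1))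
    with hS
  have hS' : (2 * S : ℤ) =
      p * (c + 2) * (2 * (a + b) + 1 - c) + (c + 2) * (1 - c) * p * (p + 1) := by
    rw [← h3p, hS]
    push_cast
    rfl
  generalize countMonomials (c + 2) a = A at *
  generalize countMonomials (c + 2) b = B at *
  zify at *
  have hA : (2 * A : ℤ) = (c + 2) * (2 * a + 1 - c) := by linear_combination h1
  have hB : (2 * B : ℤ) = (c + 2) * (2 * b + 1 - c) := by linear_combination h2
  have key : 4 * ((A : ℤ) * B + S - (c + 2) * (b + 1) * (A + p)) =
      2 * c ^ 5 + 13 * c ^ 4 + 34 * c ^ 3 + 47 * c ^ 2 + 36 * c + 12 := by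
    have : 4 * ((A : ℤ) * B + S - (c + 2) * (b + 1) * (A + p)) =
      (2 * A) * (2 * B) + 2 * (2 * S) - 2 * (c + 2) * (b + 1) * ((2 * A) + 2 * p) := by ring
    rw [this, hA, hB, hS', hb, ha, hp]
    ring
  have : (0 : ℤ) < 2 * c ^ 5 + 13 * c ^ 4 + 34 * c ^ 3 + 47 * c ^ 2 + 36 * c + 12 := by positivity
  linarith

variable {K k : Type*} [Field K] [Fintype K] [Field k] [Algebra K k] {f₀ : K[X][X]}

local notation "base" => Polynomial.map (Polynomial.mapRingHom (algebraMap K k)) f₀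

/-- An absolutely irreducible plane curve of degree `d ≥ 2` over a large finite field has a
rational point at which the second partial derivative does not vanish. -/
theorem exists_rational_point_derivative_ne_zero [IsAlgClosed k] {d : ℕ}
    (hf : IsPlaneModel base d) (hd : 2 ≤ d) (hirr : Irreducible base)
    (hder : derivative base ≠ 0) (hq : d ^ 2 * (d - 1) ^ 2 < Fintype.card K) :
    ∃ a b, (f₀.map (evalRingHom a)).eval b = 0 ∧
      ((derivative f₀).map (evalRingHom a)).eval b ≠ 0 := by
  classical
  by_contra! hcon
  have hdom : IsDomain (AdjoinRoot base) := AdjoinRoot.isDomain_of_prime hirr.prime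
  have hmder := mk_derivative_ne_zero hf hder
  have hspan := mk_derivative_mem_span (k := k) hcon
  obtain ⟨c, rfl⟩ : ∃ c, d = c + 2 := ⟨d - 2, by omega⟩
  have hd1 : 1 ≤ c + 2 := by omega
  obtain ⟨p, hp⟩ : ∃ p, p = (c + 2) * (c + 1) := ⟨_, rfl⟩
  obtain ⟨a, ha⟩ : ∃ a, a = p * c := ⟨_, rfl⟩
  obtain ⟨b, hb⟩ : ∃ b, b = p * c + (c + 2) := ⟨_, rfl⟩
  have hp2 : 2 ≤ p := by rw [hp]; nlinarith
  set q := Fintype.card K with hqdef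
  have hq1 : 1 < q := Fintype.one_lt_card
  have hqp : (c + 2) * (a + p) < q := by
    refine lt_of_eq_of_lt ?_ hq
    rw [show c + 2 - 1 = c + 1 by omega, ha, hp]
    ring
  obtain ⟨n, hn, hnsep⟩ := exists_forall_eval_derivative_ne_zero hf hd1 hder
  have hXq : (X ^ q - X : k[X]) ≠ 0 := FiniteField.X_pow_card_sub_X_ne_zero k hq1
  have hinf : {x | (n * (X ^ q - X)).eval x ≠ 0}.Infinite := by
    have := (n * (X ^ q - X)).roots.toFinset.finite_toSet.infinite_compl
    refine this.mono fun x hx => ?_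
    simpa [hn, hXq] using hx
  obtain ⟨X₀, hX₀, hX₀card⟩ := hinf.exists_subset_card_eq (b + 1)
  have hX₀n : ∀ x ∈ X₀, n.eval x ≠ 0 := fun x hx => by
    have := hX₀ hx
    simp only [Set.mem_ofPred_eq, eval_mul] at this
    exact left_ne_zero_of_mul this
  have hX₀q : ∀ x ∈ X₀, x ^ q ≠ x := fun x hx => by
    have := hX₀ hx
    simp only [Set.mem_ofPred_eq, eval_mul] at this
    simpa [sub_eq_zero] using right_ne_zero_of_mul this
  have hsep : ∀ x ∈ X₀, ∀ y, ((base).map (evalRingHom x)).eval y = 0 →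
      (derivative ((base).map (evalRingHom x))).eval y ≠ 0 := fun x hx y hy =>
    hnsep x y (hX₀n x hx) hy
  let S := X₀.sigma fun x => ((base).map (evalRingHom x)).roots.toFinset
  have hSroot : ∀ s ∈ S, s.1 ∈ X₀ ∧ ((base).map (evalRingHom s.1)).eval s.2 = 0 := fun s hs => by
    have := Finset.mem_sigma.1 hs
    exact ⟨this.1, (mem_roots'.1 (Multiset.mem_toFinset.1 this.2)).2⟩
  have hScard : S.card = (c + 2) * (b + 1) := by
    rw [Finset.card_sigma, Finset.sum_congr rfl fun x hx => ?_, Finset.sum_const, hX₀card,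
      smul_eq_mul, mul_comm]
    rw [card_roots_toFinset_of_derivative_ne_zero (hf.monic.map _).ne_zero (hsep x hx),
      hf.monic.natDegree_map, hf.natDegree_eq]
  obtain ⟨R, hR, hR0, hRS⟩ := exists_mem_contactSpace_graphHom_constHom_eq_zero hf hd1
    (ι := S) (x := fun s => s.1.1) (y := fun s => s.1.2) (m := a) (n := b + p) (j := p)
    (fun s => isCurvePoint_iff_eval.2 (hSroot s s.2).2)
    (fun s => hsep _ (hSroot s s.2).1 _ (hSroot s s.2).2) (by
      rw [Fintype.card_coe, hScard]
      refine (card_mul_lt_sum_countMonomials c hp ha hb).trans_le ?_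
      have hip : ∀ i < p, (i + 1) * c ≤ p * c := fun i hi => Nat.mul_le_mul_right _ hi
      refine sum_le_finrank_contactSpace hf hd1 hmder a b _ p ?_ ?_ ?_
      · intro i hi
        have := hip i hi
        rw [show c + 2 - 1 = c + 1 by omega, ha, mul_add (i + 1) c 1]
        omega
      · intro i hi
        have := hip i hi
        rw [show c + 2 - 1 = c + 1 by omega, hb, mul_add (i + 1) c 1]
        omega
      · intro i hi
        have := hip i hi
        rw [show c + 2 - 1 = c + 1 by omega, ha, hb, mul_add (i + 1) c 1]
        omega)
  obtain ⟨ι, s, g, e, hg, hgm, hem, rfl⟩ := exists_eq_sum_tmul hR.1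
  have he : ∀ i ∈ s, ∀ x ∈ X₀, ∀ y (h : IsCurvePoint base x y), h.hom (e i) = 0 := by
    intro i hi x hx y h
    have hs : (⟨x, y⟩ : Σ _ : k, k) ∈ S := Finset.mem_sigma.2 ⟨hx, Multiset.mem_toFinset.2
      ((mem_roots (hf.monic.map _).ne_zero).2 (isCurvePoint_iff_eval.1 h))⟩
    have h1 := hRS ⟨_, hs⟩
    rw [map_sum] at h1
    refine linearIndependent_iff'.1 hg s (fun i => h.hom (e i)) ?_ i hi
    rw [← h1]
    refine Finset.sum_congr rfl fun i _ => ?_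
    rw [graphHom_tmul, IsCurvePoint.constHom_apply, Algebra.smul_def, mul_comm]
  set P := ∏ x ∈ X₀, (X - C x) with hP
  have hPdeg : P.natDegree = b + 1 := by
    rw [hP, natDegree_prod_of_monic _ _ fun x _ => monic_X_sub_C x]
    simp [hX₀card]
  have hP0 : P ≠ 0 := (monic_prod_of_monic _ _ fun x _ => monic_X_sub_C x).ne_zero
  have he' : ∀ i, ∃ e', i ∈ s → e i = AdjoinRoot.of base P * e' := fun i => by
    by_cases hi : i ∈ s
    · obtain ⟨e', he'⟩ := exists_eq_of_prod_mul hf hsep (he i hi)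
      exact ⟨e', fun _ => he'⟩
    · exact ⟨0, fun h => (hi h).elim⟩
  choose e' he' using he'
  have he'm : ∀ i ∈ s, e' i ∈ degreeFiltration base (p - 1) := fun i hi =>
    (degreeFiltration.of_mul_mem hf hP0 (he' i hi ▸ hem i) (by omega)).1
  have hφ : IsCurvePoint base (AdjoinRoot.of base X ^ q) (AdjoinRoot.root base ^ q) :=
    isCurvePoint_pow_card_iff.2 isCurvePoint_self
  have hφX : hφ.hom (AdjoinRoot.of base X) = AdjoinRoot.of base X ^ q := by
    rw [IsCurvePoint.hom_of, aeval_X]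
  have hφY : hφ.hom (AdjoinRoot.root base) = AdjoinRoot.root base ^ q := IsCurvePoint.hom_root _
  have hT : ∑ i ∈ s, g i * hφ.hom (e' i) = 0 := by
    set T := ∑ i ∈ s, g i * hφ.hom (e' i) with hTdef
    have h1 := pow_dvd_pow_mul_graphHom hspan hφX hφY hR.2
    have h2 : graphHom hφ.hom (∑ i ∈ s, g i ⊗ₜ e i) =
        AdjoinRoot.of base (P.comp (X ^ q)) * T := by
      rw [map_sum, hTdef, Finset.mul_sum]
      refine Finset.sum_congr rfl fun i hi => ?_
      have h3 : hφ.hom (AdjoinRoot.of base P) = AdjoinRoot.of base (P.comp (X ^ q)) := by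
        rw [IsCurvePoint.hom_of, comp, hom_eval₂, map_pow]
        rfl
      rw [graphHom_tmul, he' i hi, map_mul, h3]
      ring
    rw [h2, mul_left_comm] at h1
    have h4 : IsCoprime ((AdjoinRoot.of base X ^ q - AdjoinRoot.of base X) ^ p)
        (AdjoinRoot.of base (P.comp (X ^ q))) := by
      have := ((isCoprime_comp_X_pow hX₀q).symm.pow_left (m := p)).map (AdjoinRoot.of base)
      simpa using this
    obtain ⟨z, hz⟩ := h4.dvd_of_dvd_mul_left h1
    have h5 : AdjoinRoot.mk base (derivative base) ^ p * T ∈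
        degreeFiltration base (p * (c + 1) + ((a + p) + q * (p - 1))) := by
      refine degreeFiltration.mul_mem
        (degreeFiltration.pow_mem (mk_derivative_mem_degreeFiltration hf hd1) p)
        (Submodule.sum_mem _ fun i hi => degreeFiltration.mul_mem (hgm i)
          (hφ.hom_mem_degreeFiltration (he'm i hi)))
    have h6 : AdjoinRoot.mk base (derivative base) ^ p * T =
        AdjoinRoot.of base ((X ^ q - X) ^ p) * z := by
      rw [hz]
      simp
    have hdeg : ((X ^ q - X : k[X]) ^ p).natDegree = q * p := by
      rw [natDegree_pow, FiniteField.X_pow_card_sub_X_natDegree_eq k hq1, mul_comm]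
    rw [h6] at h5
    have h7 : p * (c + 1) + ((a + p) + q * (p - 1)) < q * p := by
      obtain ⟨p', rfl⟩ : ∃ p', p = p' + 1 := ⟨p - 1, by omega⟩
      rw [Nat.add_sub_cancel, mul_add q, mul_one]
      have : (p' + 1) * (c + 1) + (a + (p' + 1)) ≤ (c + 2) * (a + (p' + 1)) := by nlinarith
      omega
    have h8 := (degreeFiltration.of_mul_mem hf (pow_ne_zero p hXq) h5 (n := q * p)
      (by rw [hdeg]; omega)).2 (by rw [hdeg]; exact h7)
    rw [h8, mul_zero] at h6
    exact (mul_eq_zero.1 h6).resolve_left (pow_ne_zero _ hmder)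
  refine hR0 (Finset.sum_eq_zero fun i hi => ?_)
  rw [he' i hi, eq_zero_of_sum_mul_frobenius_eq_zero hf hd1 hmder hφX hφY hg hgm hqp hT hi,
    mul_zero, TensorProduct.tmul_zero]

end PlaneTheorem

section Generic

theorem MvPolynomial.totalDegree_det_le {σ ι k : Type*} [CommRing k] [Fintype ι] [DecidableEq ι]
    (A : Matrix ι ι (MvPolynomial σ k)) {b : ℕ} (h : ∀ i j, (A i j).totalDegree ≤ b) :
    A.det.totalDegree ≤ Fintype.card ι * b := by
  rw [Matrix.det_apply]
  refine MvPolynomial.totalDegree_finsetSum_le fun τ _ => ?_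
  refine (MvPolynomial.totalDegree_smul_le _ _).trans ?_
  refine (MvPolynomial.totalDegree_finsetProd _ _).trans ?_
  refine (Finset.sum_le_card_nsmul _ _ b fun i _ => h _ _).trans ?_
  simp

theorem MvPolynomial.exists_aeval_algebraMap_ne_zero {K k : Type*} [Field K] [Fintype K] [Field k]
    [Algebra K k] {n : ℕ} {p : MvPolynomial (Fin n) k} (hp : p ≠ 0)
    (hdeg : p.totalDegree < Fintype.card K) :
    ∃ v : Fin n → K, MvPolynomial.eval (fun i => algebraMap K k (v i)) p ≠ 0 := by
  classical
  by_contra! hall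
  have h := MvPolynomial.schwartz_zippel_totalDegree hp
    (Finset.univ.image (algebraMap K k))
  have hcard : (Finset.univ.image (algebraMap K k)).card = Fintype.card K := by
    rw [Finset.card_image_of_injective _ (algebraMap K k).injective, Finset.card_univ]
  have hfilter : (Fintype.piFinset fun _ : Fin n => Finset.univ.image (algebraMap K k)).filter
      (fun f => MvPolynomial.eval f p = 0) =
      Fintype.piFinset fun _ : Fin n => Finset.univ.image (algebraMap K k) := by
    refine Finset.filter_true_of_mem fun f hf => ?_
    have : ∀ i, ∃ a, algebraMap K k a = f i := fun i => by
      simpa using Fintype.mem_piFinset.1 hf i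
    choose v hv using this
    have := hall v
    simp only [hv] at this
    exact this
  rw [hfilter] at h
  have hq : (0 : ℚ≥0) < Fintype.card K := by exact_mod_cast Fintype.card_pos
  simp only [Fintype.card_piFinset, hcard, Finset.prod_const, Finset.card_univ,
    Fintype.card_fin, Nat.cast_pow] at h
  rw [div_self (pow_ne_zero _ hq.ne'), le_div_iff₀ hq, one_mul] at h
  have : Fintype.card K ≤ p.totalDegree := by exact_mod_cast h
  omega

theorem Matrix.exists_det_submatrix_ne_zero {m ι L : Type*} [Fintype m] [Fintype ι] [DecidableEq ι]
    [Field L] (A : Matrix m ι L) (hA : ∀ x, A.mulVec x = 0 → x = 0) :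
    ∃ σ : ι → m, (A.submatrix σ id).det ≠ 0 := by
  have hker : LinearMap.ker A.mulVecLin = ⊥ := by
    rw [LinearMap.ker_eq_bot']
    exact fun x hx => hA x hx
  have hrank : Module.finrank L (Submodule.span L (Set.range A.row)) = Fintype.card ι := by
    rw [← Matrix.rank_eq_finrank_span_row, Matrix.rank, LinearMap.finrank_range_of_inj
      (LinearMap.ker_eq_bot.1 hker), Module.finrank_fintype_fun_eq_card]
  obtain ⟨κ, a, -, hspan, hli⟩ := exists_linearIndependent' L A.row
  have : Finite κ := hli.finite
  have : Fintype κ := Fintype.ofFinite κ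
  have hκ : Fintype.card κ = Fintype.card ι := by
    rw [← hrank, ← hspan, finrank_span_eq_card hli]
  obtain ⟨e⟩ := Fintype.card_eq.1 hκ
  refine ⟨a ∘ e.symm, ?_⟩
  have h1 : LinearIndependent L (A.submatrix (a ∘ e.symm) id).row :=
    hli.comp e.symm e.symm.injective
  rw [Matrix.linearIndependent_rows_iff_isUnit, Matrix.isUnit_iff_isUnit_det] at h1
  exact h1.ne_zero

end Generic

section Substitution

theorem MvPolynomial.IsHomogeneous.homogeneousInduction {σ R : Type*} [CommSemiring R]
    {P : ℕ → MvPolynomial σ R → Prop} (zero : ∀ m, P m 0)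
    (add : ∀ m p q, P m p → P m q → P m (p + q)) (C : ∀ c, P 0 (MvPolynomial.C c))
    (mul_X : ∀ m p i, P m p → P (m + 1) (p * MvPolynomial.X i)) {F : MvPolynomial σ R} {d : ℕ}
    (hF : F.IsHomogeneous d) : P d F := by
  have hmon : ∀ (m : ℕ) (s : σ →₀ ℕ) (c : R), s.degree = m → P m (MvPolynomial.monomial s c) := by
    intro m
    induction m with
    | zero =>
      intro s c hs
      rw [(Finsupp.degree_eq_zero_iff s).1 hs]
      exact C c
    | succ m ih =>
      intro s c hs
      obtain ⟨i, hi⟩ : ∃ i, s i ≠ 0 := by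
        by_contra! h
        rw [show s = 0 from Finsupp.ext h] at hs
        simp at hs
      have hsi : s - Finsupp.single i 1 + Finsupp.single i 1 = s :=
        Finsupp.sub_add_single_one_cancel hi
      rw [← hsi] at hs
      have := mul_X _ _ i (ih (s - Finsupp.single i 1) c (by simpa using hs))
      rwa [MvPolynomial.X, MvPolynomial.monomial_mul, mul_one, hsi] at this
  rw [F.as_sum]
  refine Finset.sum_induction _ (P d) (add d) (zero d) fun s hs => ?_
  have := hF (MvPolynomial.mem_support_iff.1 hs)
  exact hmon _ s _ ((congrArg (fun φ => φ s) Finsupp.degree_eq_weight_one).trans this)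

variable {R A : Type*} [CommRing R] [CommRing A] [Algebra R A] {n d : ℕ}
  {F : MvPolynomial (Fin n) R}

theorem natDegree_le_and_coeff_aeval_C_add_C_mul_X (hF : F.IsHomogeneous d) (a e : Fin n → A) :
    (MvPolynomial.aeval (fun i => C (a i) + C (e i) * X) F : A[X]).natDegree ≤ d ∧
      (MvPolynomial.aeval (fun i => C (a i) + C (e i) * X) F : A[X]).coeff d =
        MvPolynomial.aeval e F := by
  refine hF.homogeneousInduction (P := fun m p =>
    (MvPolynomial.aeval (fun i => C (a i) + C (e i) * X) p : A[X]).natDegree ≤ m ∧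
      (MvPolynomial.aeval (fun i => C (a i) + C (e i) * X) p : A[X]).coeff m =
        MvPolynomial.aeval e p) ?_ ?_ ?_ ?_
  · simp
  · rintro m p q ⟨hp, hp'⟩ ⟨hq, hq'⟩
    rw [map_add]
    exact ⟨natDegree_add_le_of_degree_le hp hq, by rw [coeff_add, hp', hq', map_add]⟩
  · intro c
    simp [IsScalarTower.algebraMap_eq R A A[X]]
  · rintro m p i ⟨hp, hp'⟩
    have h1 : (C (a i) + C (e i) * X : A[X]).natDegree ≤ 1 := by compute_degree
    have h2 : (C (a i) + C (e i) * X : A[X]).coeff 1 = e i := by simp [coeff_C]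
    rw [map_mul, MvPolynomial.aeval_X]
    refine ⟨natDegree_mul_le_of_le hp h1, ?_⟩
    rw [coeff_mul_add_eq_of_natDegree_le hp h1, hp', h2, map_mul, MvPolynomial.aeval_X]

theorem monic_aeval_C_add_C_mul_X (hF : F.IsHomogeneous d) (a : Fin n → A) {e : Fin n → A}
    (he : MvPolynomial.aeval e F = 1) :
    (MvPolynomial.aeval (fun i => C (a i) + C (e i) * X) F : A[X]).Monic := by
  obtain ⟨h1, h2⟩ := natDegree_le_and_coeff_aeval_C_add_C_mul_X hF a e
  exact monic_of_natDegree_le_of_coeff_eq_one d h1 (h2.trans he)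

theorem natDegree_aeval_C_add_C_mul_X [Nontrivial A] (hF : F.IsHomogeneous d) (a : Fin n → A)
    {e : Fin n → A} (he : MvPolynomial.aeval e F = 1) :
    (MvPolynomial.aeval (fun i => C (a i) + C (e i) * X) F : A[X]).natDegree = d := by
  obtain ⟨h1, h2⟩ := natDegree_le_and_coeff_aeval_C_add_C_mul_X hF a e
  refine natDegree_eq_of_le_of_coeff_ne_zero h1 ?_
  rw [h2, he]
  exact one_ne_zero

/-- The restriction of `F` to the line `w + Y e`. -/
noncomputable def lineSection (F : MvPolynomial (Fin n) R) (w e : Fin n → A) : A[X] :=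
  MvPolynomial.aeval (fun i => C (w i) + C (e i) * X) F

/-- The restriction of `F` to the plane `w + X v + Y e`. -/
noncomputable def planeSection (F : MvPolynomial (Fin n) R) (w v e : Fin n → A) : A[X][X] :=
  lineSection F (fun i => C (w i) + C (v i) * X) (fun i => C (e i))

theorem map_lineSection {A' : Type*} [CommRing A'] [Algebra R A'] (φ : A →+* A')
    (hφ : φ.comp (algebraMap R A) = algebraMap R A') (F : MvPolynomial (Fin n) R)
    (w e : Fin n → A) :
    (lineSection F w e).map φ = lineSection F (fun i => φ (w i)) (fun i => φ (e i)) := by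
  induction F using MvPolynomial.induction_on with
  | C c =>
    simp [lineSection, ← hφ, IsScalarTower.algebraMap_apply R A A[X],
      IsScalarTower.algebraMap_apply R A' A'[X]]
  | add p q hp hq =>
    simp only [lineSection, map_add, Polynomial.map_add] at hp hq ⊢
    rw [hp, hq]
  | mul_X p i hp =>
    simp only [lineSection, map_mul, Polynomial.map_mul, MvPolynomial.aeval_X] at hp ⊢
    rw [hp]
    simp

theorem map_planeSection {A' : Type*} [CommRing A'] [Algebra R A'] (φ : A →+* A')
    (hφ : φ.comp (algebraMap R A) = algebraMap R A') (F : MvPolynomial (Fin n) R)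
    (w v e : Fin n → A) :
    (planeSection F w v e).map (mapRingHom φ) =
      planeSection F (fun i => φ (w i)) (fun i => φ (v i)) (fun i => φ (e i)) := by
  have h : (mapRingHom φ).comp (algebraMap R A[X]) = algebraMap R A'[X] := by
    ext c
    simp [← hφ, IsScalarTower.algebraMap_apply R A A[X],
      IsScalarTower.algebraMap_apply R A' A'[X]]
  rw [planeSection, map_lineSection _ h]
  simp [planeSection]

theorem map_evalRingHom_planeSection (F : MvPolynomial (Fin n) R) (w v e : Fin n → A) (t : A) :
    (planeSection F w v e).map (evalRingHom t) = lineSection F (fun i => w i + v i * t) e := by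
  have h : (evalRingHom t).comp (algebraMap R A[X]) = algebraMap R A := by
    ext c
    simp [IsScalarTower.algebraMap_apply R A A[X]]
  rw [planeSection, map_lineSection _ h]
  simp

theorem eval_lineSection (F : MvPolynomial (Fin n) R) (w e : Fin n → A) (y : A) :
    (lineSection F w e).eval y = MvPolynomial.aeval (fun i => w i + e i * y) F := by
  induction F using MvPolynomial.induction_on with
  | C c => simp [lineSection, IsScalarTower.algebraMap_apply R A A[X]]
  | add p q hp hq =>
    simp only [lineSection, map_add, Polynomial.eval_add] at hp hq ⊢
    rw [hp, hq]
  | mul_X p i hp =>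
    simp only [lineSection, map_mul, Polynomial.eval_mul, MvPolynomial.aeval_X] at hp ⊢
    rw [hp]
    simp

theorem monic_planeSection (hF : F.IsHomogeneous d) (w v : Fin n → A) {e : Fin n → A}
    (he : MvPolynomial.aeval e F = 1) : (planeSection F w v e).Monic := by
  refine monic_aeval_C_add_C_mul_X hF _ ?_
  have := MvPolynomial.aeval_algebraMap_apply (B := A[X]) e F
  rw [he, map_one] at this
  exact this

theorem planeSection_mem_boundedBideg (hF : F.IsHomogeneous d) (w v e : Fin n → A) :
    planeSection F w v e ∈ boundedBideg A d := by
  refine hF.homogeneousInduction (P := fun m p => planeSection p w v e ∈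
      boundedBideg A m) ?_ ?_ ?_ ?_
  · simp [planeSection, lineSection]
  · intro m p q hp hq
    rw [planeSection, lineSection, map_add]
    exact add_mem hp hq
  · intro c
    rw [planeSection, lineSection, MvPolynomial.aeval_C]
    have := boundedBideg.monomial_mem (k := A) (m := 0) (i := 0) (l := 0) le_rfl
      (algebraMap R A c)
    simpa [IsScalarTower.algebraMap_apply R A[X] A[X][X],
      IsScalarTower.algebraMap_apply R A A[X]] using this
  · intro m p i hp
    rw [planeSection, lineSection, map_mul, MvPolynomial.aeval_X]
    refine boundedBideg.mul_mem hp ?_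
    have h1 := boundedBideg.monomial_mem (k := A) (m := 1) (i := 0) (l := 0) (by omega) (w i)
    have h2 := boundedBideg.monomial_mem (k := A) (m := 1) (i := 1) (l := 0) (by omega) (v i)
    have h3 := boundedBideg.monomial_mem (k := A) (m := 1) (i := 0) (l := 1) (by omega) (e i)
    convert! add_mem (add_mem h1 h2) h3 using 1
    simp [← C_mul_X_pow_eq_monomial]

theorem isPlaneModel_planeSection [Nontrivial A] (hF : F.IsHomogeneous d) (w v : Fin n → A)
    {e : Fin n → A} (he : MvPolynomial.aeval e F = 1) :
    IsPlaneModel (planeSection F w v e) d := by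
  refine ⟨monic_planeSection hF w v he, natDegree_aeval_C_add_C_mul_X hF _ ?_,
    planeSection_mem_boundedBideg hF w v e⟩
  have := MvPolynomial.aeval_algebraMap_apply (B := A[X]) e F
  rw [he, map_one] at this
  exact this

theorem totalDegree_coeff_aeval_le [Nontrivial R] (hF : F.IsHomogeneous d) (e : Fin n → R) (j : ℕ) :
    ((MvPolynomial.aeval
      (fun i => C (MvPolynomial.X i) + C (MvPolynomial.C (e i)) * X) F :
        (MvPolynomial (Fin n) R)[X]).coeff j).totalDegree ≤ d := by
  refine hF.homogeneousInduction (P := fun m p => ∀ j, ((MvPolynomial.aeval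
      (fun i => C (MvPolynomial.X i) + C (MvPolynomial.C (e i)) * X) p :
        (MvPolynomial (Fin n) R)[X]).coeff j).totalDegree ≤ m) ?_ ?_ ?_ ?_ j
  · simp
  · intro m p q hp hq j
    rw [map_add, coeff_add]
    exact (MvPolynomial.totalDegree_add _ _).trans (max_le (hp j) (hq j))
  · intro c j
    rw [MvPolynomial.aeval_C, IsScalarTower.algebraMap_apply R (MvPolynomial (Fin n) R),
      Polynomial.algebraMap_eq, coeff_C, MvPolynomial.algebraMap_eq]
    split_ifs <;> simp
  · intro m p i hp j
    rw [map_mul, MvPolynomial.aeval_X, mul_add, coeff_add, ← mul_assoc, coeff_mul_C]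
    refine (MvPolynomial.totalDegree_add _ _).trans (max_le ?_ ?_)
    · exact (MvPolynomial.totalDegree_mul _ _).trans
        (add_le_add (hp j) (MvPolynomial.totalDegree_X i).le)
    · cases j with
      | zero => simp
      | succ j =>
        rw [coeff_mul_X, coeff_mul_C]
        refine (MvPolynomial.totalDegree_mul _ _).trans ?_
        have := hp j
        simp only [MvPolynomial.totalDegree_C]
        omega

end Substitution

section Irreducibility

variable {k : Type*} [Field k] {n : ℕ}

/-- The substitution `x ↦ V + w + Y e`. -/
noncomputable def translation (w e : Fin n → k) :
    MvPolynomial (Fin n) k →ₐ[k] (MvPolynomial (Fin n) k)[X] :=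
  MvPolynomial.aeval fun i =>
    C (MvPolynomial.C (w i) + MvPolynomial.X i) + C (MvPolynomial.C (e i)) * X

theorem eval₂_translation_neg (w e : Fin n → k) (p : (MvPolynomial (Fin n) k)[X]) :
    eval₂ (translation w e).toRingHom X (eval₂ (translation (-w) (-e)).toRingHom X p) = p := by
  have h : (eval₂RingHom (translation w e).toRingHom X).comp
      (eval₂RingHom (translation (-w) (-e)).toRingHom X) =
      RingHom.id (MvPolynomial (Fin n) k)[X] := by
    refine Polynomial.ringHom_ext' (MvPolynomial.ringHom_ext (fun c => ?_) fun i => ?_) ?_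
    · simp [translation, IsScalarTower.algebraMap_apply k (MvPolynomial (Fin n) k)
        (MvPolynomial (Fin n) k)[X]]
    · simp [translation, IsScalarTower.algebraMap_apply k (MvPolynomial (Fin n) k)
        (MvPolynomial (Fin n) k)[X]]
      ring
    · simp
  exact congrArg (fun φ => φ p) h

theorem irreducible_translation {F : MvPolynomial (Fin n) k} (hF : Irreducible F)
    (w e : Fin n → k) : Irreducible (translation w e F) := by
  let φ : (MvPolynomial (Fin n) k)[X] ≃+* (MvPolynomial (Fin n) k)[X] :=
    { eval₂RingHom (translation w e).toRingHom X with
      invFun := eval₂ (translation (-w) (-e)).toRingHom X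
      left_inv := fun p => by simpa using eval₂_translation_neg (-w) (-e) p
      right_inv := eval₂_translation_neg w e }
  have h1 : Irreducible (C F : (MvPolynomial (Fin n) k)[X]) :=
    (Polynomial.prime_C_iff.2 hF.prime).irreducible
  have h2 : φ (C F) = translation w e F := by
    change eval₂ (translation w e).toRingHom X (C F) = _
    simp
  rw [← h2]
  exact (MulEquiv.irreducible_iff φ).2 h1

end Irreducibility

section Discriminant

theorem resultant_derivative_ne_zero {R : Type*} [CommRing R] [IsDomain R] [IsIntegrallyClosed R]
    {f : R[X]} (hf : f.Monic) (hirr : Irreducible f) (hder : derivative f ≠ 0) :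
    resultant f (derivative f) f.natDegree f.natDegree ≠ 0 := by
  let E := FractionRing R
  have hinj : Function.Injective (algebraMap R E) := IsFractionRing.injective R E
  have hirrE : Irreducible (f.map (algebraMap R E)) :=
    (hf.irreducible_iff_irreducible_map_fraction_map).1 hirr
  intro h0
  have h1 := resultant_map_map f (derivative f) f.natDegree f.natDegree (algebraMap R E)
  rw [h0, map_zero, ← derivative_map] at h1
  set g := f.map (algebraMap R E) with hg
  have hgm : g.Monic := hf.map _
  have hgn : g.natDegree = f.natDegree := hf.natDegree_map _
  have hgd : derivative g ≠ 0 := by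
    rw [hg, derivative_map]
    exact (Polynomial.map_ne_zero_iff hinj).2 hder
  have hlt : (derivative g).natDegree < g.natDegree := by
    refine natDegree_derivative_lt fun h => hgd ?_
    rw [derivative_of_natDegree_zero h]
  have hcop : IsCoprime g (derivative g) := by
    refine (hirrE.coprime_iff_not_dvd).2 fun hdvd => ?_
    exact absurd (natDegree_le_of_dvd hdvd hgd) (not_le.2 hlt)
  refine resultant_ne_zero _ _ hcop ?_
  have h2 := resultant_add_right_deg g (derivative g) g.natDegree (derivative g).natDegree
    (g.natDegree - (derivative g).natDegree) le_rfl
  rw [Nat.add_sub_cancel' hlt.le, hgm.coeff_natDegree, one_pow, one_mul, hgn] at h2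
  rw [hgn, ← h2, h1]

theorem eval_derivative_ne_zero_of_resultant_ne_zero {k : Type*} [Field k] {f : k[X]} {d : ℕ}
    (hd : d ≠ 0) (hfd : f.natDegree ≤ d) (h : resultant f (derivative f) d d ≠ 0) {ζ : k}
    (hζ : f.eval ζ = 0) : (derivative f).eval ζ ≠ 0 := by
  intro h'
  obtain ⟨p, q, -, -, hpq⟩ := exists_mul_add_mul_eq_C_resultant f (derivative f) hfd
    ((natDegree_derivative_le f).trans (by omega : f.natDegree - 1 ≤ d)) (Or.inl hd)
  have := congrArg (eval ζ) hpq
  simp only [eval_add, eval_mul, hζ, h', zero_mul, add_zero, eval_C] at this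
  exact h this.symm

end Discriminant

section Newton

theorem exists_approximate_root {B : Type*} [CommRing B] {g : B[X]} {x z c : B}
    (hz : x ∣ g.eval z) (hc : x ∣ c * (derivative g).eval z - 1) (S : Subring B) (hzS : z ∈ S)
    (hcS : c ∈ S) (hgS : ∀ y ∈ S, g.eval y ∈ S) (N : ℕ) :
    ∃ a ∈ S, x ∣ a - z ∧ x ^ N ∣ g.eval a := by
  suffices ∃ a ∈ S, x ∣ a - z ∧ x ^ (N + 1) ∣ g.eval a by
    obtain ⟨a, h1, h2, h3⟩ := this
    exact ⟨a, h1, h2, (pow_dvd_pow x N.le_succ).trans h3⟩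
  induction N with
  | zero => exact ⟨z, hzS, by simp, by simpa using hz⟩
  | succ N ih =>
    obtain ⟨a, haS, haz, ha⟩ := ih
    have hx : x ∣ g.eval a := (dvd_pow_self x N.succ_ne_zero).trans ha
    refine ⟨a - c * g.eval a, sub_mem haS (mul_mem hcS (hgS a haS)), ?_, ?_⟩
    · rw [sub_right_comm]
      exact dvd_sub haz (hx.mul_left _)
    · obtain ⟨r, hr⟩ := binomExpansion g a (-(c * g.eval a))
      have h1 : x ∣ c * (derivative g).eval a - 1 := by
        have h2 : x ∣ (derivative g).eval a - (derivative g).eval z :=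
          haz.trans (sub_dvd_eval_sub _ _ _)
        have := dvd_add hc (h2.mul_left c)
        ring_nf at this ⊢
        exact this
      have h3 : g.eval (a - c * g.eval a) = -((c * (derivative g).eval a - 1) * g.eval a) +
          r * c ^ 2 * (g.eval a * g.eval a) := by
        rw [sub_eq_add_neg, hr]
        ring
      rw [h3]
      refine dvd_add ((?_ : x ^ (N + 1 + 1) ∣ _).neg_right) (Dvd.dvd.mul_left ?_ _)
      · rw [pow_succ']
        exact mul_dvd_mul h1 ha
      · rw [pow_succ']
        exact mul_dvd_mul hx ha

end Newton

section Jets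

theorem eq_zero_of_X_pow_dvd_eval {L : Type*} [Field L] {f : L[X][X]} {d N : ℕ}
    (hf : IsPlaneModel f d) (hd : 1 ≤ d) (hirr : Irreducible f) (hN : d * (d - 1) < N) {a : L[X]}
    (ha : X ^ N ∣ f.eval a) {g : L[X][X]} (hg : g ∈ boundedBideg L (d - 1))
    (hga : X ^ N ∣ g.eval a) : g = 0 := by
  have : IsDomain (AdjoinRoot f) := AdjoinRoot.isDomain_of_prime hirr.prime
  by_contra hg0
  have hgf : AdjoinRoot.mk f g ≠ 0 := by
    refine AdjoinRoot.mk_ne_zero_of_natDegree_lt hf.monic hg0 ?_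
    have := boundedBideg.natDegree_le hg
    rw [hf.natDegree_eq]
    omega
  obtain ⟨n, hn0, hnd, h, hh⟩ := exists_mul_eq_of_of_mem_degreeFiltration hf hd
    (degreeFiltration.mk_mem hg) hgf
  obtain ⟨h, rfl⟩ := AdjoinRoot.mk_surjective h
  have h1 : f ∣ g * h - C n := by
    rw [← AdjoinRoot.mk_eq_zero, map_sub, map_mul, hh]
    simp
  have h2 : X ^ N ∣ g.eval a * h.eval a - n := by
    have := ha.trans (eval_dvd (x := a) h1)
    simpa using this
  have h3 : X ^ N ∣ n := by
    have := dvd_sub (hga.mul_right (h.eval a)) h2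
    simpa using this
  have h4 := natDegree_le_of_dvd h3 hn0
  rw [natDegree_X_pow] at h4
  omega

/-- The exponents of the monomials in two variables of degree less than `d`. -/
def triangle (d : ℕ) : Finset (ℕ × ℕ) :=
  (Finset.range d).biUnion Finset.HasAntidiagonal.antidiagonal

theorem mem_triangle {d : ℕ} {p : ℕ × ℕ} : p ∈ triangle d ↔ p.1 + p.2 < d := by
  simp [triangle]

theorem two_mul_card_triangle_le (d : ℕ) : 2 * (triangle d).card ≤ d * (d + 1) := by
  have h1 : (triangle d).card ≤ ∑ m ∈ Finset.range d, (m + 1) := by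
    refine Finset.card_biUnion_le.trans (Finset.sum_le_sum fun m _ => ?_)
    rw [Finset.Nat.card_antidiagonal]
  have h2 : 2 * ∑ m ∈ Finset.range d, (m + 1) = d * (d + 1) := by
    induction d with
    | zero => simp
    | succ d ih =>
      have := ih ((Finset.card_biUnion_le.trans (Finset.sum_le_sum fun m _ => by
        rw [Finset.Nat.card_antidiagonal])))
      rw [Finset.sum_range_succ, mul_add, this]
      ring
  omega

variable {R : Type*} [CommRing R] {d N : ℕ}

/-- The first `N` Taylor coefficients of the monomials of degree less than `d` along
`t ↦ (t, a(t))`. -/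
noncomputable def jetMatrix (d N : ℕ) (a : R[X]) : Matrix (Fin N) (triangle d) R :=
  Matrix.of fun i p => (X ^ p.1.1 * a ^ p.1.2 : R[X]).coeff i

theorem jetMatrix_map {R' : Type*} [CommRing R'] (φ : R →+* R') (a : R[X]) :
    (jetMatrix d N a).map φ = jetMatrix d N (a.map φ) := by
  ext i p
  simp only [jetMatrix, Matrix.map_apply, Matrix.of_apply]
  rw [← coeff_map]
  simp

/-- The polynomial in two variables with given coefficients. -/
noncomputable def ofTriangle (x : triangle d → R) : R[X][X] :=
  ∑ p, monomial p.1.2 (monomial p.1.1 (x p))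

theorem coeff_coeff_ofTriangle (x : triangle d → R) (i l : ℕ) :
    ((ofTriangle x).coeff l).coeff i =
      if h : i + l < d then x ⟨(i, l), mem_triangle.2 h⟩ else 0 := by
  rw [ofTriangle, finsetSum_coeff, finsetSum_coeff]
  split_ifs with h
  · rw [Finset.sum_eq_single ⟨(i, l), mem_triangle.2 h⟩]
    · simp
    · rintro ⟨⟨i', l'⟩, hp⟩ - hne
      simp only [coeff_monomial]
      split_ifs with h1
      · rw [coeff_monomial, if_neg]
        rintro rfl
        exact hne (by simp [h1])
      · simp
    · simp
  · refine Finset.sum_eq_zero ?_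
    rintro ⟨⟨i', l'⟩, hp⟩ -
    have := mem_triangle.1 hp
    simp only at this
    simp only [coeff_monomial]
    split_ifs with h1
    · rw [coeff_monomial, if_neg]
      omega
    · simp

theorem ofTriangle_mem (x : triangle d → R) : ofTriangle x ∈ boundedBideg R (d - 1) := by
  intro i l h
  rw [coeff_coeff_ofTriangle, dif_neg (by omega)]

theorem ofTriangle_coeff (hd : 1 ≤ d) {g : R[X][X]} (hg : g ∈ boundedBideg R (d - 1)) :
    ofTriangle (fun p : triangle d => (g.coeff p.1.2).coeff p.1.1) = g := by
  ext l i
  rw [coeff_coeff_ofTriangle]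
  split_ifs with h
  · rfl
  · exact (hg i l (by omega)).symm

theorem jetMatrix_mulVec (a : R[X]) (x : triangle d → R) (i : Fin N) :
    (jetMatrix d N a).mulVec x i = ((ofTriangle x).eval a).coeff i := by
  rw [ofTriangle, eval_finsetSum, finsetSum_coeff, Matrix.mulVec, dotProduct]
  refine Finset.sum_congr rfl fun p _ => ?_
  rw [eval_monomial, ← C_mul_X_pow_eq_monomial, mul_assoc, coeff_C_mul, mul_comm]
  rfl

theorem jetMatrix_mulVec_eq_zero_iff (a : R[X]) (x : triangle d → R) :
    (jetMatrix d N a).mulVec x = 0 ↔ X ^ N ∣ (ofTriangle x).eval a := by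
  rw [X_pow_dvd_iff, funext_iff]
  simp only [jetMatrix_mulVec, Pi.zero_apply]
  exact ⟨fun h i hi => h ⟨i, hi⟩, fun h i => h i i.2⟩

end Jets

section TopForm

variable {k : Type*} [CommRing k]

/-- The substitution `(x, y) ↦ (x s, y s)`. -/
noncomputable def scaleHom (k : Type*) [CommRing k] : k[X][X] →+* k[X][X][X] :=
  eval₂RingHom (S := k[X][X][X]) (eval₂RingHom (S := k[X][X][X])
    ((C : k[X][X] →+* k[X][X][X]).comp ((C : k[X] →+* k[X][X]).comp C)) (C (C X) * X)) (C X * X)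

theorem scaleHom_monomial (i l : ℕ) (c : k) :
    scaleHom k (monomial l (monomial i c)) = monomial (i + l) (monomial l (monomial i c)) := by
  simp only [scaleHom, coe_eval₂RingHom, eval₂_monomial, RingHom.comp_apply]
  simp only [← C_mul_X_pow_eq_monomial, map_mul, map_pow, pow_add]
  ring

theorem coeff_scaleHom (g : k[X][X]) (m l i : ℕ) :
    (((scaleHom k g).coeff m).coeff l).coeff i =
      if i + l = m then (g.coeff l).coeff i else 0 := by
  induction g using Polynomial.induction_on' with
  | add p q hp hq =>
    simp only [map_add, coeff_add, hp, hq]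
    split_ifs <;> simp
  | monomial l' p =>
    induction p using Polynomial.induction_on' with
    | add p q hp hq =>
      simp only [map_add, coeff_add, hp, hq]
      split_ifs <;> simp
    | monomial i' c =>
      rw [scaleHom_monomial]
      simp only [coeff_monomial]
      by_cases h1 : l' = l
      · by_cases h2 : i' = i
        · subst h1 h2
          by_cases h3 : i' + l' = m <;> simp [h3]
        · split_ifs <;> simp [h1, h2, coeff_monomial]
      · split_ifs <;> simp [h1, coeff_monomial]

theorem natDegree_scaleHom_le_iff {g : k[X][X]} {m : ℕ} :
    (scaleHom k g).natDegree ≤ m ↔ g ∈ boundedBideg k m := by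
  rw [natDegree_le_iff_coeff_eq_zero]
  constructor
  · intro h i l hil
    have := coeff_scaleHom g (i + l) l i
    rw [h _ hil, if_pos rfl] at this
    simpa using this.symm
  · intro h m' hm'
    ext l i
    rw [coeff_scaleHom]
    split_ifs with h1
    · simpa using h i l (by omega)
    · simp

theorem boundedBideg.of_mul_mem_of_natDegree_pos [IsDomain k] {g h : k[X][X]} {d : ℕ}
    (hh : 0 < h.natDegree) (hgh : g * h ∈ boundedBideg k d) : g ∈ boundedBideg k (d - 1) := by
  rw [← natDegree_scaleHom_le_iff] at hgh ⊢
  rcases eq_or_ne (scaleHom k g) 0 with h0 | h0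
  · simp [h0]
  have h1 : 1 ≤ (scaleHom k h).natDegree := by
    by_contra h2
    have h3 := boundedBideg.natDegree_le (natDegree_scaleHom_le_iff.1 (by omega :
      (scaleHom k h).natDegree ≤ 0))
    omega
  have h2 : scaleHom k h ≠ 0 := by
    rintro h3
    simp [h3] at h1
  rw [map_mul, natDegree_mul h0 h2] at hgh
  omega

end TopForm

section Bertini

theorem coeff_zero_eval {A : Type*} [CommRing A] (g : A[X][X]) (a : A[X]) :
    (g.eval a).coeff 0 = (g.map (evalRingHom 0)).eval (a.coeff 0) := by
  rw [coeff_zero_eq_eval_zero, coeff_zero_eq_eval_zero]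
  exact (eval_map_apply (evalRingHom (0 : A)) a).symm

/-- The polynomials in `t` whose coefficient of `t ^ i` has total degree at most `i`. -/
noncomputable def totalDegreeLESubalgebra (σ k : Type*) [CommRing k] :
    Subalgebra k (MvPolynomial σ k)[X] where
  carrier := {p | ∀ i, (p.coeff i).totalDegree ≤ i}
  mul_mem' {p q} hp hq i := by
    rw [coeff_mul]
    refine MvPolynomial.totalDegree_finsetSum_le fun x hx => ?_
    rw [Finset.HasAntidiagonal.mem_antidiagonal] at hx
    refine (MvPolynomial.totalDegree_mul _ _).trans ?_
    rw [← hx]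
    exact add_le_add (hp _) (hq _)
  add_mem' {p q} hp hq i := by
    rw [coeff_add]
    exact (MvPolynomial.totalDegree_add _ _).trans (max_le (hp i) (hq i))
  algebraMap_mem' c i := by
    rw [IsScalarTower.algebraMap_apply k (MvPolynomial σ k), Polynomial.algebraMap_eq, coeff_C,
      MvPolynomial.algebraMap_eq]
    split_ifs <;> simp

variable {k : Type*} [Field k] {n d : ℕ} {F : MvPolynomial (Fin n) k}

theorem irreducible_generic_planeSection (hF : F.IsHomogeneous d) (hirr : Irreducible F)
    (w : Fin n → k) {e : Fin n → k} (he : MvPolynomial.aeval e F = 1) :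
    Irreducible (planeSection F (fun i => MvPolynomial.C (w i)) (MvPolynomial.X)
      (fun i => MvPolynomial.C (e i)) : (MvPolynomial (Fin n) k)[X][X]) := by
  have he' : MvPolynomial.aeval (fun i => (MvPolynomial.C (e i) : MvPolynomial (Fin n) k)) F
      = 1 := by
    have := MvPolynomial.aeval_algebraMap_apply (B := MvPolynomial (Fin n) k) e F
    rw [he, map_one] at this
    exact this
  refine (monic_planeSection hF _ _ he').irreducible_of_irreducible_map (evalRingHom 1) _ ?_
  rw [map_evalRingHom_planeSection]
  simp only [mul_one]
  exact irreducible_translation hirr w e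

theorem irreducible_map_fractionRing {R : Type*} [CommRing R] [IsDomain R]
    [IsIntegrallyClosed R[X]] {f : R[X][X]} (hf : f.Monic) (hirr : Irreducible f) :
    Irreducible (f.map (mapRingHom (algebraMap R (FractionRing R)))) := by
  let E := FractionRing R[X]
  have hinj : Function.Injective ((algebraMap R[X] E).comp C) :=
    (IsFractionRing.injective R[X] E).comp C_injective
  let φ : (FractionRing R)[X] →+* E :=
    eval₂RingHom (IsFractionRing.lift hinj) (algebraMap R[X] E X)
  have hφ : φ.comp (mapRingHom (algebraMap R (FractionRing R))) = algebraMap R[X] E := by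
    refine Polynomial.ringHom_ext (fun c => ?_) ?_
    · simp [φ]
    · simp [φ]
  refine (hf.map _).irreducible_of_irreducible_map φ _ ?_
  rw [Polynomial.map_map, hφ]
  exact (hf.irreducible_iff_irreducible_map_fraction_map).1 hirr

theorem exists_generic_approximate_root {w e : Fin n → k} {ζ : k}
    (hζ : (lineSection F w e).eval ζ = 0) (hζ' : (derivative (lineSection F w e)).eval ζ ≠ 0)
    (N : ℕ) :
    ∃ a ∈ totalDegreeLESubalgebra (Fin n) k, a.coeff 0 = MvPolynomial.C ζ ∧
      X ^ N ∣ (planeSection F (fun i => MvPolynomial.C (w i)) (MvPolynomial.X)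
        (fun i => MvPolynomial.C (e i)) : (MvPolynomial (Fin n) k)[X][X]).eval a := by
  set f := (planeSection F (fun i => MvPolynomial.C (w i)) (MvPolynomial.X)
        (fun i => MvPolynomial.C (e i)) : (MvPolynomial (Fin n) k)[X][X]) with hf
  set S := totalDegreeLESubalgebra (Fin n) k with hS
  have hf0 : f.map (evalRingHom 0) = (lineSection F w e).map MvPolynomial.C := by
    rw [hf, map_evalRingHom_planeSection, map_lineSection MvPolynomial.C rfl]
    simp
  have hconst : ∀ c : k, (C (MvPolynomial.C c) : (MvPolynomial (Fin n) k)[X]) ∈ S :=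
    fun c => S.algebraMap_mem c
  have hX : ∀ i, (C (MvPolynomial.X i) * X : (MvPolynomial (Fin n) k)[X]) ∈ S := by
    intro i j
    rw [coeff_C_mul, coeff_X]
    split_ifs with h
    · rw [mul_one, ← h]
      exact (MvPolynomial.totalDegree_X i).le
    · simp
  have hfS : ∀ y ∈ S, f.eval y ∈ S := by
    intro y hy
    rw [hf, planeSection, eval_lineSection]
    have := (MvPolynomial.aeval (fun i => (⟨_, add_mem (add_mem (hconst (w i)) (hX i))
      (mul_mem (hconst (e i)) hy)⟩ : S)) F).2
    rw [← S.val_apply, MvPolynomial.comp_aeval_apply] at this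
    exact this
  have h1 : X ∣ f.eval (C (MvPolynomial.C ζ)) := by
    rw [X_dvd_iff, coeff_zero_eval, hf0, coeff_C_zero, eval_map_apply, hζ, map_zero]
  have h2 : X ∣ C (MvPolynomial.C ((derivative (lineSection F w e)).eval ζ)⁻¹) *
      (derivative f).eval (C (MvPolynomial.C ζ)) - 1 := by
    rw [X_dvd_iff, coeff_sub, coeff_C_mul, coeff_zero_eval, ← derivative_map, hf0, coeff_C_zero,
      derivative_map, eval_map_apply, ← map_mul, inv_mul_cancel₀ hζ']
    simp
  obtain ⟨a, haS, ha0, ha⟩ := exists_approximate_root h1 h2 S.toSubring (hconst _) (hconst _)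
    hfS N
  refine ⟨a, haS, ?_, ha⟩
  rw [X_dvd_iff, coeff_sub, coeff_C_zero, sub_eq_zero] at ha0
  exact ha0

theorem exists_irreducible_planeSection {K : Type*} [Field K] [Fintype K] [Algebra K k]
    (hd : 1 ≤ d) (hF : F.IsHomogeneous d) (hirr : Irreducible F) {w e : Fin n → k}
    (he : MvPolynomial.aeval e F = 1) {ζ : k} (hζ : (lineSection F w e).eval ζ = 0)
    (hζ' : (derivative (lineSection F w e)).eval ζ ≠ 0)
    (hq : (triangle d).card * (d * (d - 1)) < Fintype.card K) :
    ∃ v : Fin n → K, Irreducible (planeSection F w (fun i => algebraMap K k (v i)) e) := by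
  classical
  set N := d * (d - 1) + 1 with hN
  obtain ⟨a, haS, ha0, ha⟩ := exists_generic_approximate_root hζ hζ' N
  have hfirr := irreducible_generic_planeSection hF hirr w he
  set f := (planeSection F (fun i => MvPolynomial.C (w i)) (MvPolynomial.X)
        (fun i => MvPolynomial.C (e i)) : (MvPolynomial (Fin n) k)[X][X]) with hf
  have he' : MvPolynomial.aeval (fun i => (MvPolynomial.C (e i) : MvPolynomial (Fin n) k)) F
      = 1 := by
    have := MvPolynomial.aeval_algebraMap_apply (B := MvPolynomial (Fin n) k) e F
    rw [he, map_one] at this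
    exact this
  have hfm : IsPlaneModel f d := isPlaneModel_planeSection hF _ _ he'
  let L := FractionRing (MvPolynomial (Fin n) k)
  let φ := algebraMap (MvPolynomial (Fin n) k) L
  have hfL : IsPlaneModel (f.map (mapRingHom φ)) d := by
    rw [hf, map_planeSection φ (IsScalarTower.algebraMap_eq _ _ _).symm]
    refine isPlaneModel_planeSection hF _ _ ?_
    have := MvPolynomial.aeval_algebraMap_apply (B := L) (fun i => (MvPolynomial.C (e i) :
      MvPolynomial (Fin n) k)) F
    rw [he', map_one] at this
    exact this
  have haL : X ^ N ∣ (f.map (mapRingHom φ)).eval (a.map φ) := by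
    have := map_dvd (mapRingHom φ) ha
    rw [← eval_map_apply] at this
    simpa using this
  obtain ⟨σ, hσ⟩ := Matrix.exists_det_submatrix_ne_zero (jetMatrix d N (a.map φ)) fun x hx => by
    have h0 := eq_zero_of_X_pow_dvd_eval hfL hd (irreducible_map_fractionRing hfm.monic hfirr)
      (Nat.lt_succ_self _) haL (ofTriangle_mem x) ((jetMatrix_mulVec_eq_zero_iff _ x).1 hx)
    funext p
    have := coeff_coeff_ofTriangle x p.1.1 p.1.2
    rw [h0, dif_pos (mem_triangle.1 p.2)] at this
    simpa using this.symm
  have hσ0 : ((jetMatrix d N a).submatrix σ id).det ≠ 0 := by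
    intro h0
    apply hσ
    rw [← jetMatrix_map, Matrix.submatrix_map, ← RingHom.mapMatrix_apply, ← RingHom.map_det, h0,
      map_zero]
  have hdeg : ((jetMatrix d N a).submatrix σ id).det.totalDegree ≤
      Fintype.card (triangle d) * (d * (d - 1)) := by
    refine MvPolynomial.totalDegree_det_le _ fun i j => ?_
    have hXS : (X : (MvPolynomial (Fin n) k)[X]) ∈ totalDegreeLESubalgebra (Fin n) k := by
      intro i
      rw [coeff_X]
      split_ifs <;> simp
    refine ((mul_mem (pow_mem hXS j.1.1) (pow_mem haS j.1.2)) (σ i)).trans ?_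
    have := (σ i).2
    omega
  obtain ⟨v, hv⟩ := MvPolynomial.exists_aeval_algebraMap_ne_zero (K := K) hσ0
    (hdeg.trans_lt (by simpa using hq))
  refine ⟨v, ?_⟩
  set ψ : MvPolynomial (Fin n) k →+* k := MvPolynomial.eval (fun i => algebraMap K k (v i)) with hψ
  have hψC : ∀ c, ψ (MvPolynomial.C c) = c := fun c => by simp [hψ]
  set g₀ := planeSection F w (fun i => algebraMap K k (v i)) e with hg₀
  have hfg : f.map (mapRingHom ψ) = g₀ := by
    rw [hf, map_planeSection ψ (by ext c; simp [hψ])]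
    simp [hψ, hg₀]
  have hgm : IsPlaneModel g₀ d := isPlaneModel_planeSection hF _ _ he
  have hag : X ^ N ∣ g₀.eval (a.map ψ) := by
    have := map_dvd (mapRingHom ψ) ha
    rw [← eval_map_apply, hfg] at this
    simpa using this
  have hdet : ((jetMatrix d N (a.map ψ)).submatrix σ id).det ≠ 0 := by
    rw [← jetMatrix_map, Matrix.submatrix_map, ← RingHom.mapMatrix_apply, ← RingHom.map_det]
    exact hv
  have ha0' : (a.map ψ).coeff 0 = ζ := by rw [coeff_map, ha0, hψC]
  have hg0 : g₀.map (evalRingHom 0) = lineSection F w e := by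
    rw [hg₀, map_evalRingHom_planeSection]
    simp
  have key : ∀ g h : k[X][X], g.Monic → g * h = g₀ → 0 < h.natDegree →
      (g.map (evalRingHom 0)).eval ζ = 0 → (h.map (evalRingHom 0)).eval ζ ≠ 0 → False := by
    intro g h hg hgh hh hgζ hhζ
    have hgB : g ∈ boundedBideg k (d - 1) :=
      boundedBideg.of_mul_mem_of_natDegree_pos hh (hgh ▸ hgm.mem_boundedBideg)
    have hcop : IsCoprime (X ^ N) (h.eval (a.map ψ)) := by
      refine IsCoprime.pow_left ((irreducible_X.coprime_iff_not_dvd).2 fun hdvd => hhζ ?_)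
      rwa [X_dvd_iff, coeff_zero_eval, ha0'] at hdvd
    rw [← hgh, eval_mul] at hag
    have hdvd := hcop.dvd_of_dvd_mul_right hag
    rw [← ofTriangle_coeff hd hgB, ← jetMatrix_mulVec_eq_zero_iff] at hdvd
    have hz := Matrix.eq_zero_of_mulVec_eq_zero hdet (v := fun p : triangle d =>
      (g.coeff p.1.2).coeff p.1.1) (by
        funext i
        exact congrFun hdvd (σ i))
    refine hg.ne_zero ?_
    rw [← ofTriangle_coeff hd hgB, hz]
    simp [ofTriangle]
  have hne1 : g₀ ≠ 1 := by
    rintro h1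
    have := hgm.natDegree_eq
    rw [h1, natDegree_one] at this
    omega
  refine hgm.monic.irreducible_iff_natDegree.2 ⟨hne1, ?_⟩
  intro g h hg hh hgh
  by_contra! hdeg'
  have hprod : lineSection F w e = g.map (evalRingHom 0) * h.map (evalRingHom 0) := by
    rw [← hg0, ← hgh, Polynomial.map_mul]
  have hder := hζ'
  rw [hprod, derivative_mul, eval_add, eval_mul, eval_mul] at hder
  have hroot := hζ
  rw [hprod, eval_mul, mul_eq_zero] at hroot
  rcases hroot with h0 | h0
  · refine key g h hg hgh (Nat.pos_of_ne_zero hdeg'.2) h0 fun h1 => hder ?_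
    rw [h0, h1, mul_zero, zero_mul, add_zero]
  · refine key h g hh (by rw [mul_comm, hgh]) (Nat.pos_of_ne_zero hdeg'.1) h0 fun h1 => hder ?_
    rw [h0, h1, mul_zero, zero_mul, add_zero]

end Bertini

section Forms

open MvPolynomial (pderiv)

theorem exists_pderiv_ne_zero {σ K : Type*} [Field K] [Finite K]
    {F : MvPolynomial σ K} (hF : ∀ (p : ℕ) (G : MvPolynomial σ K), p.Prime → F ≠ G ^ p) :
    ∃ i, pderiv i F ≠ 0 := by
  obtain ⟨p, hp⟩ := CharP.exists K
  have hpp : p.Prime :=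
    (CharP.char_is_prime_or_zero K p).resolve_right (CharP.char_ne_zero_of_finite K p)
  have : Fact p.Prime := ⟨hpp⟩
  by_contra! h
  have hdvd : ∀ s ∈ F.support, ∀ i, p ∣ s i := by
    intro s hs i
    by_contra hi
    have h0 : s i ≠ 0 := fun h => hi (h ▸ dvd_zero p)
    have h1 := MvPolynomial.coeff_pderiv F (s - Finsupp.single i 1) (i := i)
    rw [h i, Finsupp.sub_add_single_one_cancel h0, MvPolynomial.coeff_zero] at h1
    have h2 : (((s - Finsupp.single i 1 : σ →₀ ℕ) i : ℕ) : K) + 1 = (s i : K) := by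
      rw [← Nat.cast_succ]
      congr 1
      simp
      omega
    rw [h2, eq_comm, mul_eq_zero, CharP.cast_eq_zero_iff K p] at h1
    exact h1.elim (MvPolynomial.mem_support_iff.1 hs) hi
  have hroot : ∀ c : K, ∃ b, b ^ p = c := fun c => by
    obtain ⟨b, hb⟩ := (PerfectRing.bijective_frobenius (R := K) (p := p)).2 c
    exact ⟨b, hb⟩
  choose r hr using hroot
  refine hF p (∑ s ∈ F.support, MvPolynomial.monomial
    (s.mapRange (fun m => m / p) (Nat.zero_div p)) (r (F.coeff s))) hpp ?_
  rw [sum_pow_char]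
  conv_lhs => rw [F.as_sum]
  refine Finset.sum_congr rfl fun s hs => ?_
  have hs' : p • s.mapRange (fun m => m / p) (Nat.zero_div p) = s :=
    Finsupp.ext fun i => by simp [Nat.mul_div_cancel' (hdvd s hs i)]
  rw [MvPolynomial.monomial_pow, hr, hs']

theorem derivative_lineSection {R A : Type*} [CommRing R] [CommRing A] [Algebra R A] {n : ℕ}
    (F : MvPolynomial (Fin n) R) (w e : Fin n → A) :
    derivative (lineSection F w e) = ∑ i, C (e i) * lineSection (pderiv i F) w e := by
  induction F using MvPolynomial.induction_on with
  | C c => simp [lineSection, IsScalarTower.algebraMap_apply R A A[X]]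
  | add p q hp hq =>
    simp only [lineSection, map_add, mul_add, Finset.sum_add_distrib] at hp hq ⊢
    rw [hp, hq]
  | mul_X p j hp =>
    simp only [lineSection] at hp ⊢
    rw [map_mul, derivative_mul, hp, MvPolynomial.aeval_X]
    have : ∀ i, C (e i) * MvPolynomial.aeval (fun i => C (w i) + C (e i) * X)
        (pderiv i (p * MvPolynomial.X j)) = C (e i) * MvPolynomial.aeval
          (fun i => C (w i) + C (e i) * X) (pderiv i p) * (C (w j) + C (e j) * X) +
        MvPolynomial.aeval (fun i => C (w i) + C (e i) * X) p *
          (Pi.single j (C (e j)) : Fin n → A[X]) i := by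
      intro i
      rw [MvPolynomial.pderiv_mul, map_add, map_mul, map_mul, MvPolynomial.aeval_X, mul_add]
      rcases eq_or_ne j i with rfl | hij
      · simp
        ring
      · rw [MvPolynomial.pderiv_X_of_ne hij, Pi.single_eq_of_ne' hij]
        simp
        ring
    rw [Finset.sum_congr rfl fun i _ => this i, Finset.sum_add_distrib, ← Finset.sum_mul,
      ← Finset.mul_sum]
    simp

theorem exists_eval_ne_zero_and_directional_derivative_ne_zero {K : Type*} [Field K] [Fintype K]
    {n d : ℕ} {F : MvPolynomial (Fin n) K} (hdeg : F.totalDegree ≤ d) (hF : F ≠ 0)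
    (hder : ∃ i, pderiv i F ≠ 0) (hq : d + 1 < Fintype.card K) :
    ∃ e : Fin n → K, MvPolynomial.eval e F ≠ 0 ∧
      ∑ i, MvPolynomial.C (e i) * pderiv i F ≠ 0 := by
  obtain ⟨i₀, hi₀⟩ := hder
  obtain ⟨m, hm⟩ := MvPolynomial.ne_zero_iff.1 hi₀
  set ℓ : MvPolynomial (Fin n) K :=
    ∑ i, MvPolynomial.C ((pderiv i F).coeff m) * MvPolynomial.X i with hℓ
  have hevalℓ : ∀ e : Fin n → K, MvPolynomial.eval e ℓ =
      (∑ i, MvPolynomial.C (e i) * pderiv i F).coeff m := by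
    intro e
    rw [hℓ, map_sum, MvPolynomial.coeff_sum]
    refine Finset.sum_congr rfl fun i _ => ?_
    rw [MvPolynomial.coeff_C_mul]
    simp [mul_comm]
  have hℓ0 : ℓ ≠ 0 := by
    intro h
    have := hevalℓ (Pi.single i₀ 1)
    rw [h, map_zero, MvPolynomial.coeff_sum, Finset.sum_eq_single i₀] at this
    · simp at this
      exact hm this.symm
    · intro j _ hj
      simp [hj]
    · simp
  have hℓdeg : ℓ.totalDegree ≤ 1 := by
    refine MvPolynomial.totalDegree_finsetSum_le fun i _ => ?_
    refine (MvPolynomial.totalDegree_mul _ _).trans ?_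
    simp
  obtain ⟨e, he⟩ := MvPolynomial.exists_aeval_algebraMap_ne_zero (K := K) (mul_ne_zero hF hℓ0)
    (((MvPolynomial.totalDegree_mul _ _).trans (add_le_add hdeg hℓdeg)).trans_lt hq)
  rw [map_mul, hevalℓ] at he
  refine ⟨e, left_ne_zero_of_mul he, fun h => right_ne_zero_of_mul he ?_⟩
  simp only [Algebra.algebraMap_self, RingHom.id_apply, h, MvPolynomial.coeff_zero]

theorem exists_separable_lineSection {K k : Type*} [Field K] [Fintype K] [Field k] [Algebra K k]
    {n d : ℕ} {F : MvPolynomial (Fin n) k} (hd : 1 ≤ d) (hF : F.IsHomogeneous d)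
    (hirr : Irreducible F) {e : Fin n → k} (he : MvPolynomial.aeval e F = 1)
    (hder : ∑ i, MvPolynomial.C (e i) * pderiv i F ≠ 0)
    (hq : 2 * d * d < Fintype.card K) :
    ∃ w : Fin n → K, ∀ ζ, (lineSection F (fun i => algebraMap K k (w i)) e).eval ζ = 0 →
      (derivative (lineSection F (fun i => algebraMap K k (w i)) e)).eval ζ ≠ 0 := by
  set f : (MvPolynomial (Fin n) k)[X] := lineSection F MvPolynomial.X
    (fun i => MvPolynomial.C (e i)) with hf
  have he' : MvPolynomial.aeval (fun i => (MvPolynomial.C (e i) : MvPolynomial (Fin n) k)) F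
      = 1 := by
    have := MvPolynomial.aeval_algebraMap_apply (B := MvPolynomial (Fin n) k) e F
    rw [he, map_one] at this
    exact this
  have hfm : f.Monic := monic_aeval_C_add_C_mul_X hF _ he'
  have hfd : f.natDegree = d := natDegree_aeval_C_add_C_mul_X hF _ he'
  have hfirr : Irreducible f := by
    have := irreducible_translation hirr 0 e
    simpa [translation, hf, lineSection] using this
  have hfder : derivative f ≠ 0 := by
    intro h
    apply hder
    rw [hf, derivative_lineSection] at h
    have h0 := congrArg (eval 0) h
    rw [eval_finsetSum, eval_zero] at h0
    rw [← h0]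
    refine Finset.sum_congr rfl fun i _ => ?_
    rw [eval_mul, eval_C, eval_lineSection]
    simp
  have hres := resultant_derivative_ne_zero hfm hfirr hfder
  rw [hfd] at hres
  have hcoeff : ∀ j, (f.coeff j).totalDegree ≤ d := totalDegree_coeff_aeval_le hF e
  have hcoeff' : ∀ j, ((derivative f).coeff j).totalDegree ≤ d := by
    intro j
    rw [coeff_derivative]
    refine (MvPolynomial.totalDegree_mul _ _).trans ?_
    rw [show ((j : MvPolynomial (Fin n) k) + 1) = MvPolynomial.C ((j : k) + 1) by simp,
      MvPolynomial.totalDegree_C]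
    exact hcoeff _
  have hdeg : (resultant f (derivative f) d d).totalDegree ≤ 2 * d * d := by
    refine (MvPolynomial.totalDegree_det_le _ (b := d) fun i j => ?_).trans (by
      rw [Fintype.card_fin, two_mul])
    simp only [sylvester, Matrix.of_apply]
    refine Fin.addCases (fun j => ?_) (fun j => ?_) j
    · rw [Fin.addCases_left]
      split_ifs
      · exact hcoeff' _
      · simp
    · rw [Fin.addCases_right]
      split_ifs
      · exact hcoeff _
      · simp
  obtain ⟨w, hw⟩ := MvPolynomial.exists_aeval_algebraMap_ne_zero (K := K) hres (hdeg.trans_lt hq)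
  refine ⟨w, fun ζ hζ => ?_⟩
  set ψ : MvPolynomial (Fin n) k →+* k := MvPolynomial.eval (fun i => algebraMap K k (w i)) with hψ
  have hfg : f.map ψ = lineSection F (fun i => algebraMap K k (w i)) e := by
    rw [hf, map_lineSection ψ (by ext c; simp [hψ])]
    simp [hψ]
  rw [← hfg] at hζ ⊢
  refine eval_derivative_ne_zero_of_resultant_ne_zero (d := d) (by omega)
    (natDegree_map_le.trans hfd.le) ?_ hζ
  rw [derivative_map, resultant_map_map]
  exact hw

theorem exists_nonsingular_zero_of_eval_eq_one {K k : Type*} [Field K] [Fintype K] [Field k]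
    [Algebra K k] [IsAlgClosed k] {n d : ℕ} {F : MvPolynomial (Fin n) K} (hd : 2 ≤ d)
    (hF : F.IsHomogeneous d) (hirr : Irreducible (MvPolynomial.map (algebraMap K k) F))
    {e : Fin n → K} (he : MvPolynomial.eval e F = 1)
    (hder : ∑ i, MvPolynomial.C (e i) * pderiv i F ≠ 0)
    (hq₁ : 2 * d * d < Fintype.card K)
    (hq₂ : (triangle d).card * (d * (d - 1)) < Fintype.card K)
    (hq₃ : d ^ 2 * (d - 1) ^ 2 < Fintype.card K) :
    ∃ x, MvPolynomial.eval x F = 0 ∧ ∃ i, MvPolynomial.eval x (pderiv i F) ≠ 0 := by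
  set G := MvPolynomial.map (algebraMap K k) F with hG
  have hGF : G.IsHomogeneous d := hF.map _
  have heG : MvPolynomial.aeval (fun i => algebraMap K k (e i)) G = 1 := by
    have := MvPolynomial.aeval_algebraMap_apply (B := k) e F
    rw [MvPolynomial.aeval_eq_eval, he, map_one] at this
    rw [hG, MvPolynomial.aeval_map_algebraMap]
    exact this
  have hderG : ∑ i, MvPolynomial.C (algebraMap K k (e i)) * pderiv i G ≠ 0 := by
    intro h
    apply hder
    apply MvPolynomial.map_injective _ (algebraMap K k).injective
    rw [map_zero, ← h, map_sum]
    refine Finset.sum_congr rfl fun i _ => ?_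
    rw [map_mul, MvPolynomial.map_C, MvPolynomial.pderiv_map]
  obtain ⟨w, hw⟩ := exists_separable_lineSection (K := K) (by omega) hGF hirr heG hderG hq₁
  have hdeg : (lineSection G (fun i => algebraMap K k (w i))
      (fun i => algebraMap K k (e i))).natDegree = d := natDegree_aeval_C_add_C_mul_X hGF _ heG
  obtain ⟨ζ, hζ⟩ := IsAlgClosed.exists_root (lineSection G (fun i => algebraMap K k (w i))
      (fun i => algebraMap K k (e i))) fun h => by
    have h' := natDegree_eq_zero_iff_degree_le_zero.2 h.le
    omega
  obtain ⟨v, hv⟩ := exists_irreducible_planeSection (K := K) (by omega) hGF hirr heG hζ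
    (hw ζ hζ) hq₂
  set f₀ := planeSection F w v e with hf₀
  have hbase : f₀.map (mapRingHom (algebraMap K k)) =
      planeSection G (fun i => algebraMap K k (w i)) (fun i => algebraMap K k (v i))
        (fun i => algebraMap K k (e i)) := by
    rw [hf₀, map_planeSection (algebraMap K k) rfl, hG]
    simp only [planeSection, lineSection]
    rw [MvPolynomial.aeval_map_algebraMap]
  have hmodel := isPlaneModel_planeSection hGF (fun i => algebraMap K k (w i))
    (fun i => algebraMap K k (v i)) heG
  have hder' : derivative (planeSection G (fun i => algebraMap K k (w i))
      (fun i => algebraMap K k (v i)) (fun i => algebraMap K k (e i))) ≠ 0 := by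
    intro h
    have := map_evalRingHom_planeSection G (fun i => algebraMap K k (w i))
      (fun i => algebraMap K k (v i)) (fun i => algebraMap K k (e i)) 0
    simp only [mul_zero, add_zero] at this
    apply hw ζ hζ
    rw [← this, derivative_map, h]
    simp
  rw [← hbase] at hv hmodel hder'
  obtain ⟨a, b, h1, h2⟩ := exists_rational_point_derivative_ne_zero hmodel hd hv hder' hq₃
  rw [hf₀, map_evalRingHom_planeSection, eval_lineSection, MvPolynomial.aeval_eq_eval] at h1
  refine ⟨_, h1, ?_⟩
  by_contra! hall
  apply h2
  rw [← derivative_map, hf₀, map_evalRingHom_planeSection, derivative_lineSection, eval_finsetSum]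
  refine Finset.sum_eq_zero fun i _ => ?_
  rw [eval_mul, eval_lineSection, MvPolynomial.aeval_eq_eval]
  exact (congrArg _ (hall i)).trans (mul_zero _)

theorem exists_nonsingular_zero {K k : Type*} [Field K] [Fintype K] [Field k]
    [Algebra K k] [IsAlgClosed k] {n d : ℕ} {F : MvPolynomial (Fin n) K} (hd : 2 ≤ d)
    (hF : F.IsHomogeneous d) (hirr : Irreducible (MvPolynomial.map (algebraMap K k) F))
    (hq₁ : 2 * d * d < Fintype.card K)
    (hq₂ : (triangle d).card * (d * (d - 1)) < Fintype.card K)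
    (hq₃ : d ^ 2 * (d - 1) ^ 2 < Fintype.card K) :
    ∃ x, MvPolynomial.eval x F = 0 ∧ ∃ i, MvPolynomial.eval x (pderiv i F) ≠ 0 := by
  have hpd : ∃ i, pderiv i F ≠ 0 := by
    refine exists_pderiv_ne_zero fun p G hp hFG => ?_
    rw [hFG, map_pow] at hirr
    exact not_irreducible_pow hp.ne_one hirr
  have hF0 : F ≠ 0 := by
    rintro rfl
    simp at hpd
  obtain ⟨e, he, hder⟩ := exists_eval_ne_zero_and_directional_derivative_ne_zero hF.totalDegree_le
    hF0 hpd (by nlinarith)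
  set c := MvPolynomial.eval e F with hc
  have hC : ∀ i, pderiv i (MvPolynomial.C c⁻¹ * F) = MvPolynomial.C c⁻¹ * pderiv i F :=
    fun i => by simp
  have hunit : IsUnit (MvPolynomial.C (algebraMap K k c⁻¹) : MvPolynomial (Fin n) k) :=
    IsUnit.map MvPolynomial.C (IsUnit.mk0 _ (by simpa using he))
  obtain ⟨x, h1, i, h2⟩ := exists_nonsingular_zero_of_eval_eq_one (k := k)
    (F := MvPolynomial.C c⁻¹ * F) hd
    (by simpa using (MvPolynomial.isHomogeneous_C (Fin n) c⁻¹).mul hF)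
    (by
      rw [map_mul, MvPolynomial.map_C]
      exact (irreducible_isUnit_mul hunit).2 hirr)
    (e := e) (by rw [map_mul, MvPolynomial.eval_C, ← hc, inv_mul_cancel₀ he])
    (by
      simp only [hC, mul_left_comm _ (MvPolynomial.C c⁻¹), ← Finset.mul_sum]
      exact mul_ne_zero (by simpa using he) hder) hq₁ hq₂ hq₃
  rw [map_mul, MvPolynomial.eval_C] at h1
  rw [hC, map_mul] at h2
  exact ⟨x, (mul_eq_zero.1 h1).resolve_left (inv_ne_zero he), i, right_ne_zero_of_mul h2⟩

theorem exists_nonsingular_zero_of_isHomogeneous_one {K : Type*} [Field K] {n : ℕ}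
    {F : MvPolynomial (Fin n) K} (hF : F.IsHomogeneous 1) (hF0 : F ≠ 0) :
    ∃ x, MvPolynomial.eval x F = 0 ∧ ∃ i, MvPolynomial.eval x (pderiv i F) ≠ 0 := by
  refine ⟨0, ?_, ?_⟩
  · rw [MvPolynomial.eval_zero, MvPolynomial.constantCoeff_eq]
    exact hF.coeff_eq_zero (by simp)
  · obtain ⟨s, hs⟩ := MvPolynomial.ne_zero_iff.1 hF0
    have hs1 : s.degree = 1 := by
      by_contra h
      exact hs (hF.coeff_eq_zero h)
    obtain ⟨i, rfl⟩ : ∃ i, s = Finsupp.single i 1 := by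
      obtain ⟨i, hi⟩ : ∃ i, s i ≠ 0 := by
        by_contra! h
        rw [Finsupp.ext (g := 0) h] at hs1
        simp at hs1
      have h := Finsupp.sub_add_single_one_cancel hi
      have h0 : (s - Finsupp.single i 1).degree = 0 := by
        rw [← h, map_add, Finsupp.degree_single] at hs1
        omega
      refine ⟨i, ?_⟩
      rw [← h, (Finsupp.degree_eq_zero_iff _).1 h0, zero_add]
    refine ⟨i, ?_⟩
    rw [MvPolynomial.eval_zero, MvPolynomial.constantCoeff_eq, MvPolynomial.coeff_pderiv]
    simpa using hs

end Forms

end PlaneCurve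

open MvPolynomial

/-- **Theorem 3.** Let `F` be an absolutely irreducible homogeneous polynomial of degree
`d ≥ 1` over the finite field `𝔽_q` in `n ≥ 3` variables.  If
`q > (1/2)(3d⁴ - 4d³ + 5d²)` then `F` has a non-singular zero over `𝔽_q`. -/
theorem absolutely_irreducible_form_has_nonsingular_zero
    {K : Type*} [Field K] [Fintype K] {n : ℕ} (hn : 3 ≤ n)
    {d : ℕ} (hd : 1 ≤ d)
    (F : MvPolynomial (Fin n) K)
    (hFdeg : F.totalDegree = d) (hFhom : F.IsHomogeneous d)
    (hFirr : Irreducible (MvPolynomial.map (algebraMap K (AlgebraicClosure K)) F))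
    (hq : (1 / 2 : ℝ) * (3 * (d : ℝ) ^ 4 - 4 * (d : ℝ) ^ 3 + 5 * (d : ℝ) ^ 2)
        < (Fintype.card K : ℝ)) :
    ∃ x : Fin n → K, eval x F = 0 ∧ ∃ i : Fin n, eval x (pderiv i F) ≠ 0 := by
  obtain rfl | hd2 := hd.eq_or_lt
  · refine exists_nonsingular_zero_of_isHomogeneous_one hFhom ?_
    rintro rfl
    exact hFirr.ne_zero (map_zero _)
  · obtain ⟨m, rfl⟩ : ∃ m, d = m + 2 := ⟨d - 2, by omega⟩
    have hm : (0 : ℝ) ≤ m := m.cast_nonneg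
    refine exists_nonsingular_zero (k := AlgebraicClosure K) hd2 hFhom hFirr ?_ ?_ ?_
    · rify
      push_cast at hq
      nlinarith [pow_nonneg hm 2, pow_nonneg hm 3, pow_nonneg hm 4]
    · have ht := two_mul_card_triangle_le (m + 2)
      have hsub : m + 2 - 1 = m + 1 := rfl
      rw [hsub]
      have ht' := Nat.mul_le_mul_right ((m + 2) * (m + 1)) ht
      rify at ht' ⊢
      push_cast at hq
      nlinarith [pow_nonneg hm 2, pow_nonneg hm 3, pow_nonneg hm 4]
    · have hsub : m + 2 - 1 = m + 1 := rfl
      rw [hsub]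
      rify
      push_cast at hq
      nlinarith [pow_nonneg hm 2, pow_nonneg hm 3, pow_nonneg hm 4]
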